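/- arXiv:1207.0237 — 5 statements merged into one kernel-verified Lean document; each statement's English description precedes it below -/
import Mathlib

section
/- Every strongly connected prime tournament is triangle-connected; that is, if G is a prime tournament that is strongly connected, then any two cyclic triangles of G are triangle-connected to each other. -/
/-- A tournament on a vertex type `V`: for any two distinct vertices exactly one of the
two possible directed edges is present. -/
structure Tournament (V : Type) where
  rel : V → V → Prop
  asymm : ∀ u v, rel u v → ¬ rel v u
  total : ∀ u v, u ≠ v → rel u v ∨ rel v u

namespace Tournament

variable {V : Type}

/-- `X` is a homogeneous set of the subtournament of `T` induced on `S`. -/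
def HomogOn (T : Tournament V) (S X : Set V) : Prop :=
  X ⊆ S ∧ ∀ v ∈ S \ X, (∀ x ∈ X, T.rel v x) ∨ (∀ x ∈ X, T.rel x v)

/-- The subtournament of `T` induced on `S` is prime: it is a (nonempty) tournament all
of whose homogeneous sets are trivial. -/
def PrimeOn (T : Tournament V) (S : Set V) : Prop :=
  S.Nonempty ∧ ∀ X : Set V, T.HomogOn S X → X.ncard ≤ 1 ∨ X = S

/-- The subtournament of `T` induced on `S` is isomorphic to the tournament on `Fin n`
with edge relation `r`. -/
def IsoOnFin (T : Tournament V) (S : Set V) {n : ℕ} (r : Fin n → Fin n → Prop) : Prop :=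
  ∃ f : Fin n → V, Function.Injective f ∧ Set.range f = S ∧
    ∀ i j : Fin n, r i j ↔ T.rel (f i) (f j)

/-- `T` has a subtournament isomorphic to the tournament on `Fin n` with edge relation `r`. -/
def HasSub (T : Tournament V) {n : ℕ} (r : Fin n → Fin n → Prop) : Prop :=
  ∃ f : Fin n → V, Function.Injective f ∧ ∀ i j : Fin n, r i j ↔ T.rel (f i) (f j)

/-- The subtournament of `T` induced on `S` has a subtournament isomorphic to the
tournament on `Fin n` with edge relation `r`. -/
def HasSubIn (T : Tournament V) (S : Set V) {n : ℕ} (r : Fin n → Fin n → Prop) : Prop :=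
  ∃ f : Fin n → V, Function.Injective f ∧ (∀ i, f i ∈ S) ∧
    ∀ i j : Fin n, r i j ↔ T.rel (f i) (f j)

/-- `v ∈ Ext(H)`: `v` is outside `H` and `H + v` is prime. -/
def mem_Ext (T : Tournament V) (H : Set V) (v : V) : Prop :=
  v ∉ H ∧ T.PrimeOn (insert v H)

/-- `v ∈ Z(H)`: `v` is outside `H` and `H` is a homogeneous set of `H + v`. -/
def mem_Z (T : Tournament V) (H : Set V) (v : V) : Prop :=
  v ∉ H ∧ T.HomogOn (insert v H) H

/-- `v ∈ V_x(H)`: `v` is outside `H` and `{v, x}` is a homogeneous set of `H + v`. -/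
def mem_Vx (T : Tournament V) (H : Set V) (x v : V) : Prop :=
  v ∉ H ∧ T.HomogOn (insert v H) {v, x}

/-- `C` is (the vertex set of) a cyclic triangle of `T`. -/
def CycTri (T : Tournament V) (C : Set V) : Prop :=
  ∃ a b c : V, C = {a, b, c} ∧ T.rel a b ∧ T.rel b c ∧ T.rel c a

/-- The cyclic triangles `C` and `C'` are triangle-connected: there is a sequence of
cyclic triangles from `C` to `C'` in which consecutive triangles share exactly two
vertices. -/
def TriConn (T : Tournament V) (C C' : Set V) : Prop :=
  ∃ m : ℕ, ∃ f : Fin (m + 1) → Set V,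
    f 0 = C ∧ f (Fin.last m) = C' ∧ (∀ i, T.CycTri (f i)) ∧
    ∀ i : Fin m, ((f i.castSucc) ∩ (f i.succ)).ncard = 2

/-- `T` is strongly connected. -/
def StronglyConnected (T : Tournament V) : Prop :=
  ∀ u v : V, Relation.ReflTransGen T.rel u v

/-- The subtournament of `T` induced on `S` is a transitive tournament. -/
def TransOn (T : Tournament V) (S : Set V) : Prop :=
  ∃ m : ℕ, ∃ f : Fin m → V, Function.Injective f ∧ Set.range f = S ∧
    ∀ i j : Fin m, i < j → T.rel (f i) (f j)

end Tournament

/-- The tournament `T_n` (`n = 2k+1` odd) on `Fin n`: `i → j` iff `j - i mod n ∈ {1, …, k}`. -/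
def TTrel (n : ℕ) (i j : Fin n) : Prop :=
  1 ≤ (j.val + n - i.val) % n ∧ (j.val + n - i.val) % n ≤ n / 2

/-- The tournament `U_n`: obtained from `T_n` by reversing all edges with both ends among
the first `k` vertices. -/
def UUrel (n : ℕ) (i j : Fin n) : Prop :=
  if i.val < n / 2 ∧ j.val < n / 2 then TTrel n j i else TTrel n i j

/-- The tournament `W_n` on `Fin n` (vertex `n-1` plays the role of `w_n`). -/
def WWrel (n : ℕ) (i j : Fin n) : Prop :=
  (i.val < j.val ∧ j.val < n - 1) ∨ (j.val = n - 1 ∧ i.val < n - 1 ∧ i.val % 2 = 1) ∨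
    (i.val = n - 1 ∧ j.val < n - 1 ∧ j.val % 2 = 0)

/-- The tournament `P_n` on `Fin n`: `i → j` iff `j - i ≥ 2` or `i = j + 1`. -/
def PPrel (n : ℕ) (i j : Fin n) : Prop := i.val + 2 ≤ j.val ∨ i.val = j.val + 1

/-- The tournament `D_4`: vertex `0` beats the cyclic triangle `{1, 2, 3}`. -/
def DDrel (i j : Fin 4) : Prop :=
  (i = 0 ∧ j ≠ 0) ∨ (i = 1 ∧ j = 2) ∨ (i = 2 ∧ j = 3) ∨ (i = 3 ∧ j = 1)

/-- The tournament `J_n` on `Fin n`: the identity ordering has exactly one backedge,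
from the last vertex to the first. -/
def JJrel (n : ℕ) (i j : Fin n) : Prop :=
  (i.val < j.val ∧ ¬(i.val = 0 ∧ j.val = n - 1)) ∨ (i.val = n - 1 ∧ j.val = 0)

/-- The tournament `K_n` on `Fin n`: the identity ordering has exactly one backedge,
from the last vertex to the second. -/
def KKrel (n : ℕ) (i j : Fin n) : Prop :=
  (i.val < j.val ∧ ¬(i.val = 1 ∧ j.val = n - 1)) ∨ (i.val = n - 1 ∧ j.val = 1)

/-- The tournament `K_n^*` on `Fin n`: the identity ordering has exactly one backedge,
from the second-to-last vertex to the first. -/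
def KKsrel (n : ℕ) (i j : Fin n) : Prop :=
  (i.val < j.val ∧ ¬(i.val = 0 ∧ j.val = n - 2)) ∨ (i.val = n - 2 ∧ j.val = 0)

/-- `(j, i)` (0-indexed, `i < j`) is one of the backedges of the defining ordering of `Q_n`. -/
def Qback (n i j : ℕ) : Prop :=
  (j = n - 2 ∧ i = 0) ∨ (j = n - 1 ∧ i = n - 3) ∨ (j = i + 1 ∧ j ≤ n - 3)

/-- The tournament `Q_n` on `Fin n`. -/
def QQrel (n : ℕ) (i j : Fin n) : Prop :=
  (i.val < j.val ∧ ¬ Qback n i.val j.val) ∨ (j.val < i.val ∧ Qback n j.val i.val)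

/-- `e` is a matching ordering of the tournament with edge relation `r` on `V`:
`e` lists all vertices and every vertex is the head or tail of at most one backedge. -/
def MatchingOrd {V : Type} (r : V → V → Prop) {m : ℕ} (e : Fin m → V) : Prop :=
  Function.Bijective e ∧
    ∀ i : Fin m, {j : Fin m | (i < j ∧ r (e j) (e i)) ∨ (j < i ∧ r (e i) (e j))}.Subsingleton

/-- `e` is a matching ordering of the subtournament induced on `S`. -/
def MatchingOrdOn {V : Type} (r : V → V → Prop) (S : Set V) {m : ℕ} (e : Fin m → V) : Prop :=
  Set.BijOn e Set.univ S ∧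
    ∀ i : Fin m, {j : Fin m | (i < j ∧ r (e j) (e i)) ∨ (j < i ∧ r (e i) (e j))}.Subsingleton

/-- The subtournament induced on `S` is a matching tournament. -/
def IsMatchingOn {V : Type} (r : V → V → Prop) (S : Set V) : Prop :=
  ∃ m : ℕ, ∃ e : Fin m → V, MatchingOrdOn r S e

/-- The permutation `σ_X` of the interval of integers `X = {b, …, a}` (identity off `X`):
the cycle `(b b+2 … a-2 a a-1 a-3 … b+1)` when `|X|` is odd and
`(b b+2 … a-1 a a-2 … b+1)` when `|X|` is even. -/
def sigmaX (b a x : ℕ) : ℕ :=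
  if x < b ∨ a < x then x
  else if a = b then x
  else if (x - b) % 2 = 0 then
    (if x + 2 ≤ a then x + 2 else if x + 1 ≤ a then x + 1 else x - 1)
  else (if b + 3 ≤ x then x - 2 else b)

/-- The permutation `τ_X = (b b+2)(b+1 b+3)` of `X = {b, b+1, b+2, b+3}`. -/
def tauX (b x : ℕ) : ℕ :=
  if x = b then b + 2 else if x = b + 2 then b
  else if x = b + 1 then b + 3 else if x = b + 3 then b + 1 else x

/-- The permutation `π_1` of the interval `{b, …, a}`: product of the transpositions
swapping the 1st and 2nd, 3rd and 4th, … elements of the interval. -/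
def pi1N (b a x : ℕ) : ℕ :=
  if x < b ∨ a < x then x
  else if (x - b) % 2 = 0 then (if x + 1 ≤ a then x + 1 else x)
  else x - 1

/-- The permutation `π_2` of the interval `{b, …, a}`: product of the transpositions
swapping the 2nd and 3rd, 4th and 5th, … elements of the interval. -/
def pi2N (b a x : ℕ) : ℕ :=
  if x < b ∨ a < x then x
  else if x = b then x
  else if (x - b) % 2 = 1 then (if x + 1 ≤ a then x + 1 else x)
  else x - 1

/-- The segment of the ordering `e` on positions `b, …, a` induces a transitive tournament,
with ordering given (relative to the standard ordering `f`) by the permutation `p`. -/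
def SegTrans {V : Type} (T : Tournament V) {n : ℕ} (e : Fin n → V) (b a : ℕ) (p : ℕ → ℕ) : Prop :=
  ∃ f : ℕ → V, (∀ x y : ℕ, b ≤ x → x < y → y ≤ a → T.rel (f x) (f y)) ∧
    ∀ i : Fin n, b ≤ i.val → i.val ≤ a → e i = f (p i.val)

/-- The segment of the ordering `e` on positions `b, …, a` induces a tournament isomorphic
to `P_m` (where `m = a - b + 1`), with ordering given (relative to the defining ordering
`f` of `P_m`) by the permutation `p`. -/
def SegP {V : Type} (T : Tournament V) {n : ℕ} (e : Fin n → V) (b a : ℕ) (p : ℕ → ℕ) : Prop :=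
  ∃ f : ℕ → V,
    (∀ x y : ℕ, b ≤ x → x ≤ a → b ≤ y → y ≤ a →
      (T.rel (f x) (f y) ↔ (x + 2 ≤ y ∨ x = y + 1))) ∧
    ∀ i : Fin n, b ≤ i.val → i.val ≤ a → e i = f (p i.val)

namespace Tournament

variable {V : Type}

/-- Convenient form of homogeneous sets. -/
def Hom' (T : Tournament V) (S X : Set V) : Prop :=
  X ⊆ S ∧ ∀ v ∈ S, v ∉ X → ∀ x ∈ X, ∀ y ∈ X, T.rel v x → T.rel v y

/-- Convenient form of primality. -/
def Prime' (T : Tournament V) (S : Set V) : Prop :=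
  ∀ X : Set V, T.Hom' S X → (∀ x ∈ X, ∀ y ∈ X, x = y) ∨ X = S

/-- `a → b → c → a` inside `S`. -/
def Tri (T : Tournament V) (S : Set V) (a b c : V) : Prop :=
  a ∈ S ∧ b ∈ S ∧ c ∈ S ∧ T.rel a b ∧ T.rel b c ∧ T.rel c a

/-- Moving from an edge to the next one along a cyclic triangle. -/
def Step (T : Tournament V) (S : Set V) (e f : V × V) : Prop :=
  e.2 = f.1 ∧ T.Tri S e.1 e.2 f.2

abbrev Reach (T : Tournament V) (S : Set V) : V × V → V × V → Prop :=
  Relation.ReflTransGen (T.Step S)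

/-- All triangles inside `S` are in one class. -/
def Good (T : Tournament V) (S : Set V) : Prop :=
  ∀ a b c a' b' c', T.Tri S a b c → T.Tri S a' b' c' → T.Reach S (a, b) (a', b')

/-- `u` is a twin of `x` with respect to `S`. -/
def Twin (T : Tournament V) (S : Set V) (x u : V) : Prop :=
  x ∈ S ∧ ∀ s ∈ S, s ≠ x → (T.rel s u ↔ T.rel s x)

theorem irrefl' (T : Tournament V) (u : V) : ¬ T.rel u u := fun h => T.asymm u u h h

theorem rel_flip (T : Tournament V) {u x v : V} (h1 : v ≠ u) (h2 : v ≠ x)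
    (h : T.rel u v ↔ T.rel x v) : T.rel v u ↔ T.rel v x := by
  have := T.total v u h1
  have := T.total v x h2
  have := T.asymm v u
  have := T.asymm v x
  tauto

theorem Tri.rot {T : Tournament V} {S : Set V} {a b c : V} (h : T.Tri S a b c) :
    T.Tri S b c a := ⟨h.2.1, h.2.2.1, h.1, h.2.2.2.2.1, h.2.2.2.2.2, h.2.2.2.1⟩

theorem Tri.mono {T : Tournament V} {S S' : Set V} (hs : S ⊆ S') {a b c : V}
    (h : T.Tri S a b c) : T.Tri S' a b c :=
  ⟨hs h.1, hs h.2.1, hs h.2.2.1, h.2.2.2⟩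

theorem Tri.step {T : Tournament V} {S : Set V} {a b c : V} (h : T.Tri S a b c) :
    T.Reach S (a, b) (b, c) := Relation.ReflTransGen.single ⟨rfl, h⟩

theorem Reach.symm {T : Tournament V} {S : Set V} {e f : V × V} (h : T.Reach S e f) :
    T.Reach S f e := by
  induction h with
  | refl => exact Relation.ReflTransGen.refl
  | @tail f g _ h ih =>
    obtain ⟨a, b⟩ := f
    obtain ⟨b', c⟩ := g
    obtain ⟨h1, h2⟩ := h
    simp only at h1 h2
    subst h1
    exact (h2.rot.step.trans h2.rot.rot.step).trans ih

theorem Reach.mono {T : Tournament V} {S S' : Set V} (hs : S ⊆ S') {e f : V × V}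
    (h : T.Reach S e f) : T.Reach S' e f :=
  Relation.ReflTransGen.mono (fun _ _ h => ⟨h.1, h.2.mono hs⟩) _ _ h

theorem Reach.tri {T : Tournament V} {S : Set V} {a b c : V} (h : T.Tri S a b c)
    {f : V × V} (hr : T.Reach S (a, b) f) : ∃ d, T.Tri S f.1 f.2 d := by
  induction hr with
  | refl => exact ⟨c, h⟩
  | @tail f g _ h ih =>
    obtain ⟨h1, h2⟩ := h
    exact ⟨f.1, h1 ▸ h2.rot⟩

/-- Every class of triangles spans a prime tournament. -/
theorem span {T : Tournament V} {S : Set V} (hP : T.Prime' S) {a b c : V}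
    (h : T.Tri S a b c) {v : V} (hv : v ∈ S) : ∃ w, T.Reach S (a, b) (v, w) := by
  by_contra hcon
  push Not at hcon
  have key : ∀ v ∈ S, (∀ w, ¬ T.Reach S (a, b) (v, w)) → ∀ f, T.Reach S (a, b) f →
      ((T.rel v a ↔ T.rel v f.1) ∧ (T.rel v a ↔ T.rel v f.2)) := by
    intro v hv hn
    -- local statement on one triangle
    have loc : ∀ p q r, T.Tri S p q r → T.Reach S (a, b) (p, q) → T.rel v p → T.rel v q := by
      intro p q r ht hr hvp
      have hq : v ≠ q := by
        rintro rfl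
        exact hn _ (hr.trans ht.step)
      rcases T.total v q hq with h1 | h1
      · exact h1
      · have ht' : T.Tri S p q v := ⟨ht.1, ht.2.1, hv, ht.2.2.2.1, h1, hvp⟩
        exact absurd ((hr.trans ht'.step).trans ht'.rot.step) (hn _)
    have loc2 : ∀ p q r, T.Tri S p q r → T.Reach S (a, b) (p, q) → (T.rel v p ↔ T.rel v q) ∧
        (T.rel v q ↔ T.rel v r) := by
      intro p q r ht hr
      have l1 := loc p q r ht hr
      have l2 := loc q r p ht.rot (hr.trans ht.step)
      have l3 := loc r p q ht.rot.rot ((hr.trans ht.step).trans ht.rot.step)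
      tauto
    intro f hf
    induction hf with
    | refl => exact ⟨Iff.rfl, (loc2 _ _ _ h .refl).1⟩
    | @tail f g hf hs ih =>
      obtain ⟨h1, h2⟩ := hs
      have := loc2 _ _ _ h2 hf
      rw [← h1]
      tauto
  have hom : T.Hom' S {x | ∃ w, T.Reach S (a, b) (x, w)} := by
    refine ⟨?_, ?_⟩
    · rintro x ⟨w, hw⟩
      obtain ⟨d, hd⟩ := hw.tri h
      exact hd.1
    · rintro u hu hn x ⟨w, hw⟩ y ⟨z, hz⟩ hux
      simp only [Set.mem_ofPred_eq, not_exists] at hn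
      have h1 := (key u hu hn _ hw).1
      have h2 := (key u hu hn _ hz).1
      exact h2.1 (h1.2 hux)
  rcases hP _ hom with h1 | h1
  · have : a = b := h1 a ⟨b, .refl⟩ b ⟨c, h.step⟩
    subst this
    exact T.irrefl' _ h.2.2.2.1
  · rw [← h1] at hv
    obtain ⟨w, hw⟩ := hv
    exact hcon w hw

theorem good_of_all_but {T : Tournament V} {S : Set V} (hP : T.Prime' S) {a b c : V}
    (h : T.Tri S a b c) {v : V} (hv : v ∈ S)
    (hall : ∀ p q r, T.Tri S p q r → p ≠ v → q ≠ v → r ≠ v → T.Reach S (a, b) (p, q)) :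
    T.Good S := by
  have main : ∀ p q r, T.Tri S p q r → T.Reach S (a, b) (p, q) := by
    intro p q r ht
    by_contra hn
    obtain ⟨w, hw⟩ := span hP h hv
    obtain ⟨d, hd⟩ := hw.tri h
    simp only at hd
    obtain ⟨z, hz⟩ := span hP ht hd.2.1
    obtain ⟨y, hy⟩ := hz.tri ht
    simp only at hy
    have hwv : w ≠ v := by
      rintro rfl
      exact T.irrefl' _ hd.2.2.2.1
    have hvw := hd.2.2.2.1
    by_cases hzv : z = v
    · subst hzv
      exact T.asymm _ _ hvw hy.2.2.2.1
    by_cases hyv : y = v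
    · subst hyv
      have : T.Reach S (p, q) (y, w) := (hz.trans hy.step).trans hy.rot.step
      exact hn (hw.trans this.symm)
    · exact hn ((hall _ _ _ hy hwv hzv hyv).trans hz.symm)
  intro p q r p' q' r' h1 h2
  exact (main _ _ _ h1).symm.trans (main _ _ _ h2)

/-- Restriction of homogeneous sets. -/
theorem Hom'.inter {T : Tournament V} {S S' X : Set V} (hs : S ⊆ S') (h : T.Hom' S' X) :
    T.Hom' S (X ∩ S) :=
  ⟨Set.inter_subset_right, fun v hv hn x hx y hy =>
    h.2 v (hs hv) (fun hvx => hn ⟨hvx, hv⟩) x hx.1 y hy.1⟩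

theorem Twin.rel_iff {T : Tournament V} {S : Set V} {x u : V} (h : T.Twin S x u) (hu : u ∉ S)
    {s : V} (hs : s ∈ S) (hsx : s ≠ x) : (T.rel u s ↔ T.rel x s) := by
  have h1 := h.2 s hs hsx
  have h2 : s ≠ u := by rintro rfl; exact hu hs
  have := T.total s u h2
  have := T.total s x hsx
  have := T.asymm s u
  have := T.asymm s x
  tauto

theorem ext_step {T : Tournament V} (hV : T.Prime' Set.univ) {S : Set V} (hP : T.Prime' S)
    (hG : T.Good S) {a b c : V} (h : T.Tri S a b c) (hne : S ≠ Set.univ) :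
    ∃ S', S ⊂ S' ∧ T.Prime' S' ∧ T.Good S' := by
  have hab : a ≠ b := by rintro rfl; exact T.irrefl' _ h.2.2.2.1
  have hbc : b ≠ c := by rintro rfl; exact T.irrefl' _ h.2.2.2.2.1
  have hca : c ≠ a := by rintro rfl; exact T.irrefl' _ h.2.2.2.2.2
  have haS := h.1
  have hbS := h.2.1
  have hcS := h.2.2.1
  by_cases hE : ∃ v, v ∉ S ∧ T.Prime' (insert v S)
  · obtain ⟨v, hv, hp⟩ := hE
    have hsub : S ⊆ insert v S := Set.subset_insert v S
    refine ⟨_, Set.ssubset_insert hv, hp, ?_⟩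
    refine good_of_all_but hp (h.mono hsub) (Set.mem_insert v S) ?_
    intro p q r ht h1 h2 h3
    refine (hG a b c p q r h ⟨ht.1.resolve_left h1, ht.2.1.resolve_left h2,
      ht.2.2.1.resolve_left h3, ht.2.2.2⟩).mono hsub
  push Not at hE
  -- every outside vertex is complete to `S` or a twin
  have hcase : ∀ v, v ∉ S → (∀ s ∈ S, ∀ t ∈ S, T.rel v s → T.rel v t) ∨ ∃ x, T.Twin S x v := by
    intro v hv
    have hnp := hE v hv
    unfold Prime' at hnp
    push Not at hnp
    obtain ⟨X, hX, ⟨p, hp, q, hq, hpq⟩, hXne⟩ := hnp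
    rcases hP _ (hX.inter (Set.subset_insert v S)) with h1 | h1
    · right
      have : ∃ x, x ∈ S ∧ x ∈ X ∧ v ∈ X := by
        have hp' := hX.1 hp
        have hq' := hX.1 hq
        rcases hp' with rfl | hp'
        · rcases hq' with rfl | hq'
          · exact absurd rfl hpq
          · exact ⟨q, hq', hq, hp⟩
        · rcases hq' with rfl | hq'
          · exact ⟨p, hp', hp, hq⟩
          · exact absurd (h1 p ⟨hp, hp'⟩ q ⟨hq, hq'⟩) hpq
      obtain ⟨x, hxS, hxX, hvX⟩ := this
      refine ⟨x, hxS, fun s hs hsx => ?_⟩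
      have hsX : s ∉ X := fun hsX => hsx (h1 s ⟨hsX, hs⟩ x ⟨hxX, hxS⟩)
      exact ⟨hX.2 s (Or.inr hs) hsX v hvX x hxX, hX.2 s (Or.inr hs) hsX x hxX v hvX⟩
    · left
      have hSX : S ⊆ X := fun s hs => ((Set.ext_iff.1 h1 s).2 hs).1
      have hvX : v ∉ X := by
        intro hvX
        apply hXne
        apply Set.Subset.antisymm hX.1
        exact Set.insert_subset hvX hSX
      intro s hs t ht
      exact hX.2 v (Or.inl rfl) hvX s (hSX hs) t (hSX ht)
  have hdisj : ∀ x u, u ∉ S → T.Twin S x u → ¬ (∀ s ∈ S, ∀ t ∈ S, T.rel u s → T.rel u t) := by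
    intro x u hu ht hz
    have hom : T.Hom' S (S \ {x}) := by
      refine ⟨Set.sdiff_subset, ?_⟩
      intro v hv hn p hp q hq hvp
      have hvx : v = x := by
        by_contra hvx
        exact hn ⟨hv, hvx⟩
      subst hvx
      exact (ht.rel_iff hu hq.1 hq.2).1 (hz p hp.1 q hq.1 ((ht.rel_iff hu hp.1 hp.2).2 hvp))
    rcases hP _ hom with h1 | h1
    · by_cases hax : a = x
      · subst hax
        exact hbc (h1 b ⟨hbS, hab.symm⟩ c ⟨hcS, hca⟩)
      · by_cases hbx : b = x
        · subst hbx
          exact hca (h1 c ⟨hcS, hbc.symm⟩ a ⟨haS, hax⟩)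
        · exact hab (h1 a ⟨haS, hax⟩ b ⟨hbS, hbx⟩)
    · have := ht.1
      rw [← h1] at this
      exact this.2 rfl
  have huniq : ∀ x y u, u ∉ S → T.Twin S x u → T.Twin S y u → x = y := by
    intro x y u hu hx hy
    by_contra hxy
    have hom : T.Hom' S {x, y} := by
      refine ⟨?_, ?_⟩
      · rintro z (rfl | rfl)
        · exact hx.1
        · exact hy.1
      · intro v hv hn p hp q hq hvp
        simp only [Set.mem_insert_iff, Set.mem_singleton_iff, not_or] at hn hp hq
        have e1 := hx.2 v hv hn.1
        have e2 := hy.2 v hv hn.2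
        rcases hp with rfl | rfl <;> rcases hq with rfl | rfl <;> tauto
    rcases hP _ hom with h1 | h1
    · exact hxy (h1 x (by simp) y (by simp))
    · have ha' : a = x ∨ a = y := by rw [← h1] at haS; exact haS
      have hb' : b = x ∨ b = y := by rw [← h1] at hbS; exact hbS
      have hc' : c = x ∨ c = y := by rw [← h1] at hcS; exact hcS
      grind
  -- some twin exists
  have hex : ∃ x u, u ∉ S ∧ T.Twin S x u := by
    by_contra hno
    push Not at hno
    have hom : T.Hom' Set.univ S := by
      refine ⟨Set.subset_univ _, fun v _ hv => ?_⟩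
      exact (hcase v hv).resolve_right (fun ⟨x, hx⟩ => hno x v hv hx)
    rcases hV _ hom with h1 | h1
    · exact hab (h1 a haS b hbS)
    · exact hne h1
  obtain ⟨x, u0, hu0, htw0⟩ := hex
  have hxS := htw0.1
  have hpair : ∃ u v, u ∉ S ∧ v ∉ S ∧ v ≠ u ∧ T.Twin S x u ∧ ¬ T.Twin S x v ∧
      ¬ (T.rel v u ↔ T.rel v x) := by
    by_contra hno
    push Not at hno
    have hagree : ∀ v, ¬ (v = x ∨ (v ∉ S ∧ T.Twin S x v)) →
        ∀ u, (u = x ∨ (u ∉ S ∧ T.Twin S x u)) → (T.rel v u ↔ T.rel v x) := by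
      intro v hv u hu
      rcases hu with rfl | ⟨hu, htu⟩
      · exact Iff.rfl
      · push Not at hv
        by_cases hvS : v ∈ S
        · exact htu.2 v hvS hv.1
        · refine hno u v hu hvS ?_ htu (hv.2 hvS)
          rintro rfl
          exact hv.2 hvS htu
    have hom : T.Hom' Set.univ {v | v = x ∨ (v ∉ S ∧ T.Twin S x v)} := by
      refine ⟨Set.subset_univ _, fun v _ hv p hp q hq hvp => ?_⟩
      exact (hagree v hv q hq).2 ((hagree v hv p hp).1 hvp)
    rcases hV _ hom with h1 | h1
    · have := h1 x (Or.inl rfl) u0 (Or.inr ⟨hu0, htw0⟩)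
      subst this
      exact hu0 hxS
    · have hmem : ∀ s ∈ S, s = x := by
        intro s hs
        have : s ∈ {v | v = x ∨ (v ∉ S ∧ T.Twin S x v)} := h1 ▸ Set.mem_univ s
        rcases this with h2 | h2
        · exact h2
        · exact absurd hs h2.1
      exact hab ((hmem a haS).trans (hmem b hbS).symm)
  obtain ⟨u, v, hu, hv, hvu, htw, hntw, hdis⟩ := hpair
  have hsub : S ⊆ insert v (insert u S) := fun s hs => Or.inr (Or.inr hs)
  have hvS' : v ∈ insert v (insert u S) := Or.inl rfl
  have huS' : u ∈ insert v (insert u S) := Or.inr (Or.inl rfl)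
  have hxu : x ≠ u := by rintro rfl; exact hu hxS
  have hxv : x ≠ v := by rintro rfl; exact hv hxS
  have hp : T.Prime' (insert v (insert u S)) := by
    intro X hX
    have hXm : ∀ z ∈ X, z = v ∨ z = u ∨ z ∈ S := fun z hz => hX.1 hz
    rcases hP _ (hX.inter hsub) with h1 | h1
    · left
      -- at most one vertex of `S` in `X`
      have agree : ∀ s ∈ S, s ∉ X → ∀ p ∈ X, ∀ q ∈ X, (T.rel s p ↔ T.rel s q) :=
        fun s hs hsX p hp q hq => ⟨hX.2 s (hsub hs) hsX p hp q hq, hX.2 s (hsub hs) hsX q hq p hp⟩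
      have one : ∀ s ∈ S, s ∈ X → ∀ t ∈ S, t ≠ s → t ∉ X :=
        fun s hs hsX t ht hts htX => hts (h1 t ⟨htX, ht⟩ s ⟨hsX, hs⟩)
      have huv : ¬ (u ∈ X ∧ v ∈ X) := by
        rintro ⟨huX, hvX⟩
        apply hntw
        refine ⟨hxS, fun s hs hsx => ?_⟩
        by_cases hsX : s ∈ X
        · exfalso
          have ht : T.Twin S s u :=
            ⟨hs, fun t ht hts => agree t ht (one s hs hsX t ht hts) u huX s hsX⟩
          exact hsx (huniq s x u hu ht htw)
        · exact (agree s hs hsX v hvX u huX).trans (htw.2 s hs hsx)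
      have hus : ∀ s ∈ S, s ∈ X → u ∉ X := by
        intro s hs hsX huX
        have ht : T.Twin S s u :=
          ⟨hs, fun t ht hts => agree t ht (one s hs hsX t ht hts) u huX s hsX⟩
        have hsx : s = x := huniq s x u hu ht htw
        subst hsx
        have hvX : v ∉ X := fun hvX => huv ⟨huX, hvX⟩
        exact hdis ⟨hX.2 v hvS' hvX u huX s hsX, hX.2 v hvS' hvX s hsX u huX⟩
      have hvs : ∀ s ∈ S, s ∈ X → v ∉ X := by
        intro s hs hsX hvX
        have ht : T.Twin S s v :=
          ⟨hs, fun t ht hts => agree t ht (one s hs hsX t ht hts) v hvX s hsX⟩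
        have hsx : s ≠ x := by rintro rfl; exact hntw ht
        have huX : u ∉ X := hus s hs hsX
        have e1 : T.rel u v ↔ T.rel u s :=
          ⟨hX.2 u huS' huX v hvX s hsX, hX.2 u huS' huX s hsX v hvX⟩
        have e2 : T.rel u s ↔ T.rel x s := htw.rel_iff hu hs hsx
        have e3 := ht.2 x hxS hsx.symm
        exact hdis (T.rel_flip hvu hxv.symm ((e1.trans e2).trans e3.symm))
      intro p hp q hq
      rcases hXm p hp with rfl | rfl | hpS <;> rcases hXm q hq with rfl | rfl | hqS
      · rfl
      · exact absurd ⟨hq, hp⟩ huv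
      · exact absurd hp (hvs q hqS hq)
      · exact absurd ⟨hp, hq⟩ huv
      · rfl
      · exact absurd hp (hus q hqS hq)
      · exact absurd hq (hvs p hpS hp)
      · exact absurd hq (hus p hpS hp)
      · exact h1 p ⟨hp, hpS⟩ q ⟨hq, hqS⟩
    · right
      have hSX : S ⊆ X := fun s hs => ((Set.ext_iff.1 h1 s).2 hs).1
      have huX : u ∈ X := by
        by_contra huX
        exact hdisj x u hu htw fun s hs t ht => hX.2 u huS' huX s (hSX hs) t (hSX ht)
      have hvX : v ∈ X := by
        by_contra hvX
        exact hdis ⟨hX.2 v hvS' hvX u huX x (hSX hxS), hX.2 v hvS' hvX x (hSX hxS) u huX⟩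
      exact Set.Subset.antisymm hX.1 (Set.insert_subset hvX (Set.insert_subset huX hSX))
  refine ⟨_, ⟨hsub, fun hh => hv (hh hvS')⟩, hp, ?_⟩
  -- triangles through `u` inside `S + u`
  have htri : ∀ q r, q ∈ S → r ∈ S → T.rel u q → T.rel q r → T.rel r u → T.Tri S x q r := by
    intro q r hq hr h1 h2 h3
    have hqx : q ≠ x := by
      rintro rfl
      have hrq : r ≠ q := by rintro rfl; exact T.irrefl' _ h2
      exact T.asymm _ _ h2 ((htw.2 r hr hrq).1 h3)
    have hrx : r ≠ x := by
      rintro rfl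
      exact T.asymm _ _ h2 ((htw.rel_iff hu hq hqx).1 h1)
    exact ⟨hxS, hq, hr, (htw.rel_iff hu hq hqx).1 h1, h2, (htw.2 r hr hrx).1 h3⟩
  refine good_of_all_but hp (h.mono hsub) hvS' ?_
  intro p q r ht h1 h2 h3
  have hp' := ht.1.resolve_left h1
  have hq' := ht.2.1.resolve_left h2
  have hr' := ht.2.2.1.resolve_left h3
  obtain ⟨_, _, _, r1, r2, r3⟩ := id ht
  rcases hp' with rfl | hpS
  · have hqS : q ∈ S := hq'.resolve_left (by rintro rfl; exact T.irrefl' _ r1)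
    have hrS : r ∈ S := hr'.resolve_left (by rintro rfl; exact T.irrefl' _ r3)
    have := htri q r hqS hrS r1 r2 r3
    exact ((hG _ _ _ _ _ _ h this.rot).mono hsub).trans ht.step.symm
  rcases hq' with rfl | hqS
  · have hrS : r ∈ S := hr'.resolve_left (by rintro rfl; exact T.irrefl' _ r2)
    have := htri r p hrS hpS r2 r3 r1
    exact ((hG _ _ _ _ _ _ h this.rot).mono hsub).trans ht.rot.rot.step
  rcases hr' with rfl | hrS
  · have := htri p q hpS hqS r3 r1 r2
    exact (hG _ _ _ _ _ _ h this.rot).mono hsub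
  · exact (hG _ _ _ _ _ _ h ⟨hpS, hqS, hrS, r1, r2, r3⟩).mono hsub

theorem tri_base {T : Tournament V} {a b c : V} (h1 : T.rel a b) (h2 : T.rel b c)
    (h3 : T.rel c a) : T.Prime' {a, b, c} ∧ T.Good {a, b, c} := by
  have hab : a ≠ b := by rintro rfl; exact T.irrefl' _ h1
  have hbc : b ≠ c := by rintro rfl; exact T.irrefl' _ h2
  have hca : c ≠ a := by rintro rfl; exact T.irrefl' _ h3
  have n1 := T.asymm _ _ h1
  have n2 := T.asymm _ _ h2
  have n3 := T.asymm _ _ h3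
  have na := T.irrefl' a
  have nb := T.irrefl' b
  have nc := T.irrefl' c
  have ma : a ∈ ({a, b, c} : Set V) := by simp
  have mb : b ∈ ({a, b, c} : Set V) := by simp
  have mc : c ∈ ({a, b, c} : Set V) := by simp
  constructor
  · intro X hX
    have hm : ∀ z ∈ X, z = a ∨ z = b ∨ z = c := fun z hz => hX.1 hz
    have ca := hX.2 a ma
    have cb := hX.2 b mb
    have cc := hX.2 c mc
    by_cases hall : a ∈ X ∧ b ∈ X ∧ c ∈ X
    · right
      apply Set.Subset.antisymm hX.1
      rintro z (rfl | rfl | rfl)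
      · exact hall.1
      · exact hall.2.1
      · exact hall.2.2
    · left
      have k1 : ¬ (a ∈ X ∧ b ∈ X) := fun ⟨p, q⟩ =>
        n2 (cc (fun r => hall ⟨p, q, r⟩) a p b q h3)
      have k2 : ¬ (b ∈ X ∧ c ∈ X) := fun ⟨p, q⟩ =>
        n3 (ca (fun r => hall ⟨r, p, q⟩) b p c q h1)
      have k3 : ¬ (c ∈ X ∧ a ∈ X) := fun ⟨p, q⟩ =>
        n1 (cb (fun r => hall ⟨q, r, p⟩) c p a q h2)
      intro p hp q hq
      rcases hm p hp with rfl | rfl | rfl <;> rcases hm q hq with rfl | rfl | rfl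
      all_goals first
        | rfl
        | exact (k1 ⟨hp, hq⟩).elim
        | exact (k1 ⟨hq, hp⟩).elim
        | exact (k2 ⟨hp, hq⟩).elim
        | exact (k2 ⟨hq, hp⟩).elim
        | exact (k3 ⟨hp, hq⟩).elim
        | exact (k3 ⟨hq, hp⟩).elim
  · have ht : T.Tri {a, b, c} a b c := ⟨ma, mb, mc, h1, h2, h3⟩
    have main : ∀ p q r, T.Tri {a, b, c} p q r → T.Reach {a, b, c} (a, b) (p, q) := by
      rintro p q r ⟨hp, hq, hr, r1, r2, r3⟩
      rcases hp with rfl | rfl | rfl <;> rcases hq with rfl | rfl | rfl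
      all_goals first
        | exact absurd r1 ‹_›
        | exact .refl
        | exact ht.step
        | exact ht.step.trans ht.rot.step
    intro p q r p' q' r' h1 h2
    exact (main _ _ _ h1).symm.trans (main _ _ _ h2)

theorem good_univ [Fintype V] {T : Tournament V} (hV : T.Prime' Set.univ) : T.Good Set.univ := by
  have main : ∀ n : ℕ, ∀ S : Set V, Sᶜ.ncard ≤ n → T.Prime' S → T.Good S →
      (∃ a b c, T.Tri S a b c) → T.Good Set.univ := by
    intro n
    induction n with
    | zero =>
      intro S hn _ hG _
      have : Sᶜ = ∅ := (Set.ncard_eq_zero (Set.toFinite _)).1 (by omega)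
      rw [Set.compl_empty_iff] at this
      exact this ▸ hG
    | succ n ih =>
      intro S hn hP hG ⟨a, b, c, h⟩
      by_cases hS : S = Set.univ
      · exact hS ▸ hG
      obtain ⟨S', hss, hP', hG'⟩ := ext_step hV hP hG h hS
      refine ih S' ?_ hP' hG' ⟨a, b, c, h.mono hss.1⟩
      have := Set.ncard_lt_ncard (compl_lt_compl_iff_lt.2 hss) (Set.toFinite _)
      omega
  intro a b c a' b' c' h h'
  obtain ⟨hp, hg⟩ := tri_base h.2.2.2.1 h.2.2.2.2.1 h.2.2.2.2.2
  exact main _ {a, b, c} le_rfl hp hg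
    ⟨a, b, c, by simp, by simp, by simp, h.2.2.2⟩ a b c a' b' c' h h'

theorem TriConn.snoc {T : Tournament V} {C D E : Set V} (h : T.TriConn C D) (hE : T.CycTri E)
    (hDE : (D ∩ E).ncard = 2) : T.TriConn C E := by
  obtain ⟨m, f, h0, hl, hc, hs⟩ := h
  refine ⟨m + 1, Fin.snoc f E, ?_, ?_, ?_, ?_⟩
  · rw [← Fin.castSucc_zero, Fin.snoc_castSucc, h0]
  · rw [Fin.snoc_last]
  · intro i
    refine Fin.lastCases ?_ (fun j => ?_) i
    · rw [Fin.snoc_last]; exact hE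
    · rw [Fin.snoc_castSucc]; exact hc j
  · intro i
    refine Fin.lastCases ?_ (fun j => ?_) i
    · rw [Fin.snoc_castSucc, Fin.succ_last, Fin.snoc_last, hl]; exact hDE
    · rw [Fin.snoc_castSucc, Fin.succ_castSucc, Fin.snoc_castSucc]; exact hs j

theorem TriConn.change {T : Tournament V} {C : Set V} {a b c d : V}
    (h : T.TriConn C {a, b, c}) (h1 : T.Tri Set.univ a b c) (h2 : T.Tri Set.univ a b d) :
    T.TriConn C {a, b, d} := by
  by_cases hcd : c = d
  · exact hcd ▸ h
  obtain ⟨-, -, -, r1, r2, r3⟩ := h1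
  obtain ⟨-, -, -, -, r4, r5⟩ := h2
  refine h.snoc ⟨a, b, d, rfl, r1, r4, r5⟩ ?_
  have hab : a ≠ b := by rintro rfl; exact T.irrefl' _ r1
  have : ({a, b, c} ∩ {a, b, d} : Set V) = {a, b} := by
    ext z
    simp only [Set.mem_inter_iff, Set.mem_insert_iff, Set.mem_singleton_iff]
    constructor
    · rintro ⟨h1 | h1 | h1, h2 | h2 | h2⟩ <;> first | (left; assumption) | (right; assumption) | skip
      exact absurd (h1.symm.trans h2) hcd
    · tauto
  rw [this, Set.ncard_pair hab]

theorem triConn_of_reach {T : Tournament V} {a b c : V} (h : T.Tri Set.univ a b c) {f : V × V}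
    (hr : T.Reach Set.univ (a, b) f) :
    ∀ d, T.Tri Set.univ f.1 f.2 d → T.TriConn {a, b, c} {f.1, f.2, d} := by
  have h0 : T.TriConn {a, b, c} {a, b, c} :=
    ⟨0, fun _ => {a, b, c}, rfl, rfl, fun _ => ⟨a, b, c, rfl, h.2.2.2⟩, fun i => i.elim0⟩
  induction hr with
  | refl => exact fun d hd => h0.change h hd
  | @tail f g _ hs ih =>
    intro d hd
    obtain ⟨p, q⟩ := f
    obtain ⟨q', r⟩ := g
    obtain ⟨e, ht⟩ := hs
    simp only at e ht hd ih ⊢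
    subst e
    have h1 := ih r ht
    have e1 : ({p, q, r} : Set V) = {q, r, p} := by
      ext z; simp only [Set.mem_insert_iff, Set.mem_singleton_iff]; tauto
    rw [e1] at h1
    exact h1.change ht.rot hd

end Tournament

/-- Every strongly connected prime tournament is triangle-connected. -/
theorem stmt4 {V : Type} [Fintype V] (T : Tournament V)
    (hP : T.PrimeOn Set.univ) (hSC : T.StronglyConnected) :
    ∀ C C' : Set V, T.CycTri C → T.CycTri C' → T.TriConn C C' := by
  have hV : T.Prime' Set.univ := by
    intro X hX
    have : T.HomogOn Set.univ X := by
      refine ⟨hX.1, fun v hv => ?_⟩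
      by_cases hex : ∃ x ∈ X, T.rel v x
      · obtain ⟨x, hx, hvx⟩ := hex
        exact Or.inl fun y hy => hX.2 v hv.1 hv.2 x hx y hy hvx
      · right
        intro x hx
        have hne : v ≠ x := by rintro rfl; exact hv.2 hx
        exact (T.total v x hne).resolve_left fun hvx => hex ⟨x, hx, hvx⟩
    rcases hP.2 X this with h1 | h1
    · left
      intro x hx y hy
      exact (Set.ncard_le_one (Set.toFinite X)).1 h1 x hx y hy
    · exact Or.inr h1
  rintro C C' ⟨a, b, c, rfl, h⟩ ⟨a', b', c', rfl, h'⟩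
  have t : T.Tri Set.univ a b c := ⟨trivial, trivial, trivial, h⟩
  have t' : T.Tri Set.univ a' b' c' := ⟨trivial, trivial, trivial, h'⟩
  exact Tournament.triConn_of_reach t (Tournament.good_univ hV _ _ _ _ _ _ t t') c' t'
end

section
/- A tournament G has no subtournament isomorphic to D_4 if and only if G can be written as T_n(I^1,…,I^n) or as I_2(T_n(I^1,…,I^n), I), where n ≥ 1 is odd, I_2 carries the standard ordering of a transitive tournament on two vertices, and I^1,…,I^n, I are transitive tournaments. -/
/-- The subtournament of `T` induced on `S` can be written as `T_n(I¹, …, Iⁿ)` with `n`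
odd and `I¹, …, Iⁿ` transitive tournaments. -/
def Tournament.IsTnOfTrans {V : Type} (T : Tournament V) (S : Set V) : Prop :=
  ∃ n : ℕ, Odd n ∧ ∃ P : Fin n → Set V, (∀ i, (P i).Nonempty) ∧ (⋃ i, P i) = S ∧
    (∀ i j, i ≠ j → Disjoint (P i) (P j)) ∧
    (∀ i j, i ≠ j → ∀ u ∈ P i, ∀ v ∈ P j, (T.rel u v ↔ TTrel n i j)) ∧
    ∀ i, T.TransOn (P i)

section Aux

/-- Enumerating a finite set along a strict linear order. -/
lemma aux_enum {V : Type} [Fintype V] (R : V → V → Prop) (S : Set V)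
    (hirr : ∀ u ∈ S, ¬ R u u)
    (htot : ∀ u ∈ S, ∀ v ∈ S, u ≠ v → R u v ∨ R v u)
    (htr : ∀ u ∈ S, ∀ v ∈ S, ∀ w ∈ S, R u v → R v w → R u w) :
    ∃ m : ℕ, ∃ f : Fin m → V, Function.Injective f ∧ Set.range f = S ∧
      ∀ i j : Fin m, i < j → R (f i) (f j) := by
  classical
  let r : S → S → Prop := fun a b => R a.1 b.1
  haveI : IsStrictTotalOrder S r :=
    { trichotomous := by
        intro a b h1 h2
        by_contra hne
        rcases htot a.1 a.2 b.1 b.2 (fun h => hne (Subtype.ext h)) with h | h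
        · exact h1 h
        · exact h2 h
      irrefl := fun a => hirr a.1 a.2
      trans := fun a b c h1 h2 => htr a.1 a.2 b.1 b.2 c.1 c.2 h1 h2 }
  letI : LinearOrder S := linearOrderOfSTO r
  let e := Fintype.orderIsoFinOfCardEq S (rfl : Fintype.card S = Fintype.card S)
  refine ⟨Fintype.card S, fun i => (e i).1, ?_, ?_, ?_⟩
  · intro i j h
    exact e.injective (Subtype.ext h)
  · ext x
    constructor
    · rintro ⟨i, rfl⟩
      exact (e i).2
    · intro hx
      exact ⟨e.symm ⟨x, hx⟩, by simp⟩
  · intro i j hij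
    have : e i < e j := e.lt_iff_lt.2 hij
    exact this

/-- The number of sign changes. -/
noncomputable def auxC (s : ℕ → Prop) : ℕ → ℕ
  | 0 => 0
  | i + 1 => by
      classical
      exact auxC s i + if (s i ↔ s (i + 1)) then 0 else 1

lemma auxC_succ (s : ℕ → Prop) (i : ℕ) :
    ((s i ↔ s (i + 1)) ∧ auxC s (i + 1) = auxC s i) ∨
    (¬ (s i ↔ s (i + 1)) ∧ auxC s (i + 1) = auxC s i + 1) := by
  classical
  by_cases h : (s i ↔ s (i + 1))
  · left; exact ⟨h, by simp [auxC, h]⟩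
  · right; exact ⟨h, by simp [auxC, h]⟩

lemma auxC_mono (s : ℕ → Prop) : Monotone (auxC s) := by
  apply monotone_nat_of_le_succ
  intro n
  rcases auxC_succ s n with h | h <;> omega

lemma auxC_par (s : ℕ → Prop) (i : ℕ) : (auxC s i % 2 = 0 ↔ (s 0 ↔ s i)) := by
  induction i with
  | zero => simp [auxC]
  | succ i ih =>
    rcases auxC_succ s i with ⟨h, h'⟩ | ⟨h, h'⟩
    · rw [h', ih]; tauto
    · rw [h']
      have : (auxC s i + 1) % 2 = 0 ↔ ¬ (auxC s i % 2 = 0) := by omega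
      rw [this, ih]; tauto

lemma auxC_surj (s : ℕ → Prop) (i x : ℕ) (hx : x ≤ auxC s i) : ∃ k ≤ i, auxC s k = x := by
  induction i with
  | zero => exact ⟨0, le_rfl, by simp [auxC] at *; omega⟩
  | succ i ih =>
    by_cases h : x ≤ auxC s i
    · obtain ⟨k, hk, h⟩ := ih h
      exact ⟨k, by omega, h⟩
    · refine ⟨i + 1, le_rfl, ?_⟩
      rcases auxC_succ s i with h | h <;> omega

/-- Position of the block number `c` in `T_n`. -/
def auxIdx (n c : ℕ) : ℕ := if c % 2 = 0 then c / 2 else if c = n then 0 else (c + n) / 2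

lemma aux_mod (n a b : ℕ) (ha : a < n) (hb : b < n) :
    (b + n - a) % n = if a ≤ b then b - a else b + n - a := by
  split_ifs with h
  · have : b + n - a = (b - a) + n := by omega
    rw [this, Nat.add_mod_right, Nat.mod_eq_of_lt (by omega)]
  · rw [Nat.mod_eq_of_lt (by omega)]

lemma auxIdx_lt (n c : ℕ) (hn : n % 2 = 1) (hc : c ≤ n) : auxIdx n c < n := by
  unfold auxIdx
  split_ifs <;> omega

lemma auxIdx_eq (n a b : ℕ) (hn : n % 2 = 1) (ha : a ≤ n) (hb : b ≤ n)
    (h : auxIdx n a = auxIdx n b) : a = b ∨ (a = 0 ∧ b = n) ∨ (a = n ∧ b = 0) := by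
  unfold auxIdx at h
  split_ifs at h <;> omega

lemma auxIdx_surj (n i : ℕ) (hn : n % 2 = 1) (hi : i < n) : ∃ c, c + 1 ≤ n ∧ auxIdx n c = i := by
  by_cases h : 2 * i < n
  · exact ⟨2 * i, by omega, by unfold auxIdx; split_ifs <;> omega⟩
  · exact ⟨2 * i - n, by omega, by unfold auxIdx; split_ifs <;> omega⟩

lemma aux_TT (n a b : ℕ) (hn : n % 2 = 1) (hab : a ≤ b) (hb : b ≤ n) (i j : Fin n)
    (hi : auxIdx n a = i.val) (hj : auxIdx n b = j.val) (hne : i ≠ j) :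
    (TTrel n i j ↔ a % 2 = b % 2) ∧ (TTrel n j i ↔ a % 2 ≠ b % 2) := by
  have hne' : i.val ≠ j.val := fun h => hne (Fin.ext h)
  have h1 := i.2
  have h2 := j.2
  unfold TTrel
  rw [aux_mod n i j h1 h2, aux_mod n j i h2 h1]
  unfold auxIdx at hi hj
  generalize i.val = x at *
  generalize j.val = y at *
  obtain ⟨q, rfl⟩ : ∃ q, n = 2 * q + 1 := ⟨n / 2, by omega⟩
  have : (2 * q + 1) / 2 = q := by omega
  rw [this]
  split_ifs at hi hj ⊢ <;> constructor <;> omega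

/-- The out-neighbours of a vertex of `T_n` are ordered by their offsets. -/
lemma aux_off (n : ℕ) (hn : n % 2 = 1) (i j l : Fin n) (hj : (j.val + n - i.val) % n ≤ n / 2)
    (hl : (l.val + n - i.val) % n ≤ n / 2) (h : TTrel n j l) :
    (j.val + n - i.val) % n < (l.val + n - i.val) % n := by
  have h1 := i.2
  have h2 := j.2
  have h3 := l.2
  unfold TTrel at h
  rw [aux_mod n _ _ h1 h2] at *
  rw [aux_mod n _ _ h1 h3] at *
  rw [aux_mod n _ _ h2 h3] at *
  split_ifs at * <;> omega

lemma aux_off_inj (n : ℕ) (i j l : Fin n)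
    (h : (j.val + n - i.val) % n = (l.val + n - i.val) % n) : j = l := by
  have h1 := i.2
  have h2 := j.2
  have h3 := l.2
  rw [aux_mod n _ _ h1 h2, aux_mod n _ _ h1 h3] at h
  apply Fin.ext
  split_ifs at * <;> omega

namespace Tournament

variable {V : Type} (T : Tournament V)

lemma aux_irr (u : V) : ¬ T.rel u u := fun h => T.asymm u u h h

/-- `v` beats the cyclic triangle `a, b, c`. -/
def auxD (v a b c : V) : Prop :=
  T.rel v a ∧ T.rel v b ∧ T.rel v c ∧ T.rel a b ∧ T.rel b c ∧ T.rel c a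

lemma hasSub_iff : T.HasSub DDrel ↔ ∃ v a b c, T.auxD v a b c := by
  constructor
  · rintro ⟨f, -, hf⟩
    refine ⟨f 0, f 1, f 2, f 3, ?_, ?_, ?_, ?_, ?_, ?_⟩ <;> rw [← hf] <;> simp [DDrel]
  · rintro ⟨v, a, b, c, h1, h2, h3, h4, h5, h6⟩
    have n1 := T.asymm _ _ h1
    have n2 := T.asymm _ _ h2
    have n3 := T.asymm _ _ h3
    have n4 := T.asymm _ _ h4
    have n5 := T.asymm _ _ h5
    have n6 := T.asymm _ _ h6
    have i1 := T.aux_irr v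
    have i2 := T.aux_irr a
    have i3 := T.aux_irr b
    have i4 := T.aux_irr c
    have key : ∀ i j : Fin 4, DDrel i j ↔ T.rel (![v, a, b, c] i) (![v, a, b, c] j) := by
      intro i j
      fin_cases i <;> fin_cases j <;> simp [DDrel, *]
    refine ⟨![v, a, b, c], ?_, key⟩
    intro i j hij
    by_contra hne
    have hd : DDrel i j ∨ DDrel j i := by
      revert hne
      clear hij
      fin_cases i <;> fin_cases j <;> simp [DDrel]
    rcases hd with h | h
    · rw [key, hij] at h; exact T.aux_irr _ h
    · rw [key, hij] at h; exact T.aux_irr _ h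

lemma transOn_of [Fintype V] (S : Set V)
    (h : ∀ a ∈ S, ∀ b ∈ S, ∀ c ∈ S, T.rel a b → T.rel b c → ¬ T.rel c a) : T.TransOn S := by
  apply aux_enum
  · exact fun u _ => T.aux_irr u
  · exact fun u _ v _ h => T.total u v h
  · intro u hu v hv w hw h1 h2
    rcases T.total u w (by rintro rfl; exact T.asymm _ _ h1 h2) with h3 | h3
    · exact h3
    · exact absurd h3 (h u hu v hv w hw h1 h2)

lemma TransOn.noCyc {T : Tournament V} {S : Set V} (h : T.TransOn S) {a b c : V} (ha : a ∈ S) (hb : b ∈ S)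
    (hc : c ∈ S) (h1 : T.rel a b) (h2 : T.rel b c) (h3 : T.rel c a) : False := by
  obtain ⟨m, f, -, rfl, hf⟩ := h
  obtain ⟨i, rfl⟩ := ha
  obtain ⟨j, rfl⟩ := hb
  obtain ⟨k, rfl⟩ := hc
  have key : ∀ x y : Fin m, T.rel (f x) (f y) → x < y := by
    intro x y hxy
    rcases lt_trichotomy x y with h | h | h
    · exact h
    · subst h; exact absurd hxy (T.aux_irr _)
    · exact absurd hxy (T.asymm _ _ (hf _ _ h))
  exact lt_irrefl _ ((key _ _ h1).trans ((key _ _ h2).trans (key _ _ h3)))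

/-- Blow-ups of `T_n` contain no `D_4`. -/
lemma IsTnOfTrans.noD {T : Tournament V} {S : Set V} (h : T.IsTnOfTrans S) {v a b c : V} (hv : v ∈ S)
    (ha : a ∈ S) (hb : b ∈ S) (hc : c ∈ S) : ¬ T.auxD v a b c := by
  rintro ⟨h1, h2, h3, h4, h5, h6⟩
  obtain ⟨n, hodd, P, -, rfl, -, hrel, htr⟩ := h
  obtain ⟨i, hv⟩ := Set.mem_iUnion.1 hv
  obtain ⟨j, ha⟩ := Set.mem_iUnion.1 ha
  obtain ⟨k, hb⟩ := Set.mem_iUnion.1 hb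
  obtain ⟨l, hc⟩ := Set.mem_iUnion.1 hc
  have hout : ∀ x, ∀ j, x ∈ P j → T.rel v x → (j.val + n - i.val) % n ≤ n / 2 := by
    intro x j hx hvx
    by_cases hij : i = j
    · subst hij; simp
    · exact ((hrel i j hij v hv x hx).1 hvx).2
  have hle : ∀ x y, ∀ j k, x ∈ P j → y ∈ P k → T.rel v x → T.rel v y → T.rel x y →
      (j.val + n - i.val) % n ≤ (k.val + n - i.val) % n := by
    intro x y j k hx hy hvx hvy hxy
    by_cases hjk : j = k
    · subst hjk; rfl
    · exact (aux_off n (Nat.odd_iff.1 hodd) i j k (hout x j hx hvx) (hout y k hy hvy)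
        ((hrel j k hjk x hx y hy).1 hxy)).le
  have e1 := hle a b j k ha hb h1 h2 h4
  have e2 := hle b c k l hb hc h2 h3 h5
  have e3 := hle c a l j hc ha h3 h1 h6
  have f1 : j = k := aux_off_inj n i j k (by omega)
  have f2 : k = l := aux_off_inj n i k l (by omega)
  subst f1 f2
  exact (htr j).noCyc ha hb hc h4 h5 h6

set_option maxHeartbeats 1000000 in
/-- Locally transitive tournaments are blow-ups of `T_n`. -/
lemma tn_of_loc [Fintype V] (A : Set V) (hA : A.Nonempty)
    (hout : ∀ v ∈ A, ∀ a ∈ A, ∀ b ∈ A, ∀ c ∈ A, T.rel v a → T.rel v b → T.rel v c →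
      T.rel a b → T.rel b c → T.rel c a → False)
    (hin : ∀ v ∈ A, ∀ a ∈ A, ∀ b ∈ A, ∀ c ∈ A, T.rel a v → T.rel b v → T.rel c v →
      T.rel a b → T.rel b c → T.rel c a → False) : T.IsTnOfTrans A := by
  obtain ⟨v, hv⟩ := hA
  obtain ⟨s, hs⟩ : ∃ s : V → Prop, ∀ u, s u ↔ (u = v ∨ T.rel v u) := ⟨_, fun u => Iff.rfl⟩
  have hns : ∀ u, ¬ s u → T.rel u v := by
    intro u hu
    rw [hs] at hu
    push Not at hu
    exact (T.total u v hu.1).resolve_right hu.2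
  have hcyc : ∀ a ∈ A, ∀ b ∈ A, ∀ c ∈ A, (s a ↔ s b) → (s b ↔ s c) →
      T.rel a b → T.rel b c → T.rel c a → False := by
    intro a ha b hb c hc hab hbc h1 h2 h3
    by_cases hsa : s a
    · have hsb := hab.1 hsa
      have hsc := hbc.1 hsb
      rw [hs] at hsa hsb hsc
      have := T.asymm
      have := T.aux_irr
      have := hout v hv a ha b hb c hc
      grind
    · have hsb : ¬ s b := fun h => hsa (hab.2 h)
      have hsc : ¬ s c := fun h => hsb (hbc.2 h)
      exact hin v hv a ha b hb c hc (hns _ hsa) (hns _ hsb) (hns _ hsc) h1 h2 h3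
  -- one minus, two plus
  have hm : ∀ u ∈ A, ∀ w ∈ A, ∀ x ∈ A, ¬ s u → s w → s x → T.rel w u → T.rel w x →
      T.rel u x → False := by
    intro u hu w hw x hx su sw sx h1 h2 h3
    have huv := hns u su
    rw [hs] at sw sx
    have := T.asymm
    have := hin x hx w hw u hu v hv h2 h3
    grind
  have hp : ∀ u ∈ A, ∀ w ∈ A, ∀ x ∈ A, s u → ¬ s w → ¬ s x → T.rel w u → T.rel w x →
      T.rel u x → False := by
    intro u hu w hw x hx su sw sx h1 h2 h3
    have hwv := hns w sw
    have hxv := hns x sx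
    rw [hs] at su
    have := T.asymm
    have := hout w hw u hu x hx v hv h1 h2 hwv h3 hxv
    grind
  obtain ⟨m, f, finj, hrange, hf⟩ := aux_enum
      (fun u w => u ≠ w ∧ (T.rel u w ↔ (s u ↔ s w))) A (by simp)
      (by
        intro u _ w _ huw
        have h1 := T.total u w huw
        have h2 := T.asymm u w
        by_cases h : (s u ↔ s w)
        · rcases h1 with h1 | h1
          · left; tauto
          · right; exact ⟨huw.symm, by tauto⟩
        · rcases h1 with h1 | h1
          · right; exact ⟨huw.symm, by tauto⟩
          · left; exact ⟨huw, by tauto⟩)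
      (by
        rintro u hu w hw x hx ⟨n1, e1⟩ ⟨n2, e2⟩
        have hux : u ≠ x := by
          rintro rfl
          have := T.asymm u w
          have := T.total u w n1
          tauto
        refine ⟨hux, ?_⟩
        by_contra hcon
        have t1 := T.total u w n1
        have t2 := T.total w x n2
        have t3 := T.total u x hux
        have a1 := T.asymm u w
        have a2 := T.asymm w x
        have a3 := T.asymm u x
        have c1 := hcyc u hu w hw x hx
        have m1 := hm x hx u hu w hw
        have m2 := hm w hw x hx u hu
        have m3 := hm u hu w hw x hx
        have m4 := hp u hu w hw x hx
        have m5 := hp w hw x hx u hu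
        have m6 := hp x hx u hu w hw
        clear hm hp hcyc hns hs hin hout
        by_cases su : s u <;> by_cases sw : s w <;> by_cases sx : s x <;>
          simp only [su, sw, sx, iff_true, iff_false, not_true_eq_false, not_false_eq_true,
            true_iff, false_iff, forall_true_left, not_not] at e1 e2 hcon m1 m2 m3 m4 m5 m6 c1 <;>
          clear su sw sx <;> grind)
  have hm0 : 0 < m := by
    rw [← hrange] at hv
    obtain ⟨i, -⟩ := hv
    exact i.pos
  -- the sign sequence
  let σ : ℕ → Prop := fun k => if h : k < m then s (f ⟨k, h⟩) else True
  have hσ : ∀ k : Fin m, σ k.val ↔ s (f k) := by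
    intro k
    simp [σ]
  obtain ⟨C, hC⟩ : ∃ C : ℕ → ℕ, C = auxC σ := ⟨_, rfl⟩
  have hCmono : Monotone C := hC ▸ auxC_mono σ
  have hpar : ∀ k l : Fin m, (C k % 2 = C l % 2 ↔ (s (f k) ↔ s (f l))) := by
    intro k l
    have h1 := auxC_par σ k
    have h2 := auxC_par σ l
    rw [← hC, hσ] at h1 h2
    have h3 : C k % 2 = C l % 2 ↔ (C k % 2 = 0 ↔ C l % 2 = 0) := by omega
    rw [h3, h1, h2]
    clear h1 h2 h3 hm hp hcyc hns hs hin hout hf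
    tauto
  have hrel : ∀ k l : Fin m, T.rel (f k) (f l) ↔
      ((k.val < l.val ∧ C k % 2 = C l % 2) ∨ (l.val < k.val ∧ C k % 2 ≠ C l % 2)) := by
    intro k l
    rcases lt_trichotomy k l with h | h | h
    · have := (hf k l h).2
      rw [this, ← hpar]
      have : k.val < l.val := h
      omega
    · subst h
      simp [T.aux_irr]
    · obtain ⟨h1, h2⟩ := hf l k h
      have h3 := T.total _ _ h1
      have h4 := T.asymm (f l) (f k)
      have h5 : T.rel (f k) (f l) ↔ ¬ T.rel (f l) (f k) :=
        ⟨fun h h' => h4 h' h, fun h => h3.resolve_left h⟩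
      rw [h5, h2, ← hpar]
      have : l.val < k.val := h
      omega
  obtain ⟨n, hn, hn1, hn2⟩ : ∃ n, n % 2 = 1 ∧ C (m - 1) ≤ n ∧ n ≤ C (m - 1) + 1 := by
    by_cases h : C (m - 1) % 2 = 1
    · exact ⟨_, h, by omega, by omega⟩
    · exact ⟨C (m - 1) + 1, by omega, by omega, by omega⟩
  have hCn : ∀ k : Fin m, C k ≤ n := by
    intro k
    have h1 := k.2
    have := hCmono (show k.val ≤ m - 1 by omega)
    omega
  refine ⟨n, Nat.odd_iff.2 hn, fun i => {x | ∃ k : Fin m, f k = x ∧ auxIdx n (C k) = i.val},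
    ?_, ?_, ?_, ?_, ?_⟩
  · intro i
    obtain ⟨c, hc, hci⟩ := auxIdx_surj n i hn i.2
    obtain ⟨k, hk, hkc⟩ := auxC_surj σ (m - 1) c (by rw [← hC]; omega)
    rw [← hC] at hkc
    exact ⟨f ⟨k, by omega⟩, ⟨k, by omega⟩, rfl, by simp only [hkc, hci]⟩
  · rw [← hrange]
    ext x
    simp only [Set.mem_iUnion, Set.mem_setOf_eq, Set.mem_range]
    constructor
    · rintro ⟨i, k, h, -⟩
      exact ⟨k, h⟩
    · rintro ⟨k, h⟩
      exact ⟨⟨auxIdx n (C k), auxIdx_lt n _ hn (hCn k)⟩, k, h, rfl⟩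
  · intro i j hij
    rw [Set.disjoint_left]
    rintro x ⟨k, h, hk⟩ ⟨l, h', hl⟩
    have := finj (h.trans h'.symm)
    subst this
    exact hij (Fin.ext (hk.symm.trans hl))
  · rintro i j hij _ ⟨k, rfl, hk⟩ _ ⟨l, rfl, hl⟩
    rw [hrel]
    rcases lt_trichotomy k.val l.val with h | h | h
    · rw [(aux_TT n (C k) (C l) hn (hCmono h.le) (hCn l) i j hk hl hij).1]
      omega
    · have : k = l := Fin.ext h
      subst this
      exact absurd (Fin.ext (hk.symm.trans hl)) hij
    · rw [(aux_TT n (C l) (C k) hn (hCmono h.le) (hCn k) j i hl hk hij.symm).2]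
      omega
  · intro i
    apply transOn_of
    rintro _ ⟨k, rfl, hk⟩ _ ⟨l, rfl, hl⟩ _ ⟨p, rfl, hp⟩
    rw [hrel, hrel, hrel]
    have e1 := auxIdx_eq n _ _ hn (hCn k) (hCn l) (hk.trans hl.symm)
    have e2 := auxIdx_eq n _ _ hn (hCn l) (hCn p) (hl.trans hp.symm)
    have e3 := auxIdx_eq n _ _ hn (hCn k) (hCn p) (hk.trans hp.symm)
    have mono : ∀ x y : Fin m, C x < C y → x.val < y.val := by
      intro x y h
      by_contra h'
      have := hCmono (not_lt.1 h')
      omega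
    have m1 := mono k l
    have m2 := mono l k
    have m3 := mono l p
    have m4 := mono p l
    have m5 := mono k p
    have m6 := mono p k
    clear mono
    omega

lemma aux_main [Fintype V] [Nonempty V] (hD : ∀ v a b c, ¬ T.auxD v a b c) :
    T.IsTnOfTrans Set.univ ∨
        ∃ A B : Set V, A.Nonempty ∧ B.Nonempty ∧ Disjoint A B ∧ A ∪ B = Set.univ ∧
          (∀ u ∈ A, ∀ v ∈ B, T.rel u v) ∧ T.IsTnOfTrans A ∧ T.TransOn B := by
  classical
  have hout : ∀ v a b c, T.rel v a → T.rel v b → T.rel v c →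
      T.rel a b → T.rel b c → T.rel c a → False :=
    fun v a b c h1 h2 h3 h4 h5 h6 => hD v a b c ⟨h1, h2, h3, h4, h5, h6⟩
  by_cases hin : ∀ v a b c, T.rel a v → T.rel b v → T.rel c v →
      T.rel a b → T.rel b c → T.rel c a → False
  · left
    exact T.tn_of_loc _ Set.univ_nonempty (fun v _ a _ b _ c _ => hout v a b c)
      (fun v _ a _ b _ c _ => hin v a b c)
  right
  push Not at hin
  obtain ⟨z0, a0, b0, c0, hz1, hz2, hz3, hcab, hcbc, hcca⟩ := hin
  let Z : V × V × V → Finset V := fun t =>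
    Finset.univ.filter fun z => T.rel t.1 z ∧ T.rel t.2.1 z ∧ T.rel t.2.2 z
  let Cy : Finset (V × V × V) :=
    Finset.univ.filter fun t => T.rel t.1 t.2.1 ∧ T.rel t.2.1 t.2.2 ∧ T.rel t.2.2 t.1
  obtain ⟨⟨a, b, c⟩, ht, hmax⟩ := Cy.exists_max_image (fun t => (Z t).card)
    ⟨(a0, b0, c0), by simp [Cy, *]⟩
  have hmax0 := hmax (a0, b0, c0) (by simp [Cy, *])
  simp only [Cy, Finset.mem_filter, Finset.mem_univ, true_and] at ht
  obtain ⟨hab, hbc, hca⟩ := ht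
  have memZ : ∀ x a b c, x ∈ Z (a, b, c) ↔ T.rel a x ∧ T.rel b x ∧ T.rel c x := by
    intro x a b c
    simp [Z]
  have hne : (Z (a, b, c)).Nonempty := by
    rw [← Finset.card_pos]
    refine lt_of_lt_of_le (Finset.card_pos.2 ⟨z0, ?_⟩) hmax0
    rw [memZ]
    exact ⟨hz1, hz2, hz3⟩
  have hdom : ∀ u, u ∉ Z (a, b, c) → ∀ z ∈ Z (a, b, c), T.rel u z := by
    intro u hu z hz
    have hzu : u ≠ z := by rintro rfl; exact hu hz
    refine (T.total u z hzu).resolve_right fun hzu' => ?_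
    rw [memZ] at hu hz
    obtain ⟨za, zb, zc⟩ := hz
    have ua : u ≠ a := by rintro rfl; exact T.asymm _ _ za hzu'
    have ub : u ≠ b := by rintro rfl; exact T.asymm _ _ zb hzu'
    have uc : u ≠ c := by rintro rfl; exact T.asymm _ _ zc hzu'
    have ta := T.total u a ua
    have tb := T.total u b ub
    have tc := T.total u c uc
    have k0 := hout u a b c
    have k1 := hout a b z u
    have k2 := hout b c z u
    have k3 := hout c a z u
    clear hmax hmax0 hout hD memZ hne
    grind
  refine ⟨{x | x ∉ Z (a, b, c)}, {x | x ∈ Z (a, b, c)}, ⟨a, ?_⟩, ?_, ?_, ?_, ?_, ?_, ?_⟩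
  · rw [Set.mem_setOf_eq, memZ]
    exact fun h => T.aux_irr _ h.1
  · obtain ⟨z, hz⟩ := hne
    exact ⟨z, hz⟩
  · rw [Set.disjoint_left]
    exact fun x hx hx' => hx hx'
  · ext x
    simp only [Set.mem_union, Set.mem_setOf_eq, Set.mem_univ, iff_true]
    tauto
  · exact fun u hu z hz => hdom u hu z hz
  · apply T.tn_of_loc _ ⟨a, ?_⟩ (fun v _ a _ b _ c _ => hout v a b c)
    · intro v hv x hx y hy w hw h1 h2 h3 h4 h5 h6
      have hle := hmax (x, y, w) (by simp [Cy, *])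
      have hss : Z (a, b, c) ⊂ Z (x, y, w) := by
        rw [Finset.ssubset_iff_of_subset]
        · exact ⟨v, by rw [memZ]; exact ⟨h1, h2, h3⟩, hv⟩
        · intro z hz
          rw [memZ]
          exact ⟨hdom x hx z hz, hdom y hy z hz, hdom w hw z hz⟩
      exact absurd (Finset.card_lt_card hss) (not_lt.2 hle)
    · rw [Set.mem_setOf_eq, memZ]
      exact fun h => T.aux_irr _ h.1
  · apply transOn_of
    intro x hx y hy w hw h1 h2 h3
    have hx := (memZ _ _ _ _).1 hx
    have hy := (memZ _ _ _ _).1 hy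
    have hw := (memZ _ _ _ _).1 hw
    exact hout a x y w hx.1 hy.1 hw.1 h1 h2 h3

end Tournament

end Aux

/-- A tournament has no subtournament isomorphic to `D_4` iff it can be written as
`T_n(I¹, …, Iⁿ)` or as `I_2(T_n(I¹, …, Iⁿ), I)` with `n ≥ 1` odd and
`I¹, …, Iⁿ, I` transitive. -/
theorem stmt7 {V : Type} [Fintype V] [Nonempty V] (T : Tournament V) :
    ¬ T.HasSub DDrel ↔
      (T.IsTnOfTrans Set.univ ∨
        ∃ A B : Set V, A.Nonempty ∧ B.Nonempty ∧ Disjoint A B ∧ A ∪ B = Set.univ ∧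
          (∀ u ∈ A, ∀ v ∈ B, T.rel u v) ∧ T.IsTnOfTrans A ∧ T.TransOn B) := by
  rw [T.hasSub_iff]
  constructor
  · intro h
    push Not at h
    exact T.aux_main h
  · rintro h ⟨v, a, b, c, hd⟩
    rcases h with h | ⟨A, B, -, -, -, hAB, hdom, hA, hB⟩
    · exact h.noD (Set.mem_univ _) (Set.mem_univ _) (Set.mem_univ _) (Set.mem_univ _) hd
    · have hmem : ∀ x, x ∈ A ∨ x ∈ B := by
        intro x
        rw [← Set.mem_union, hAB]
        trivial
      have key : ∀ x y, T.rel x y → x ∈ B → y ∈ B := by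
        intro x y hxy hx
        rcases hmem y with hy | hy
        · exact absurd hxy (T.asymm _ _ (hdom y hy x hx))
        · exact hy
      have hd' := hd
      obtain ⟨h1, h2, h3, h4, h5, h6⟩ := hd'
      have hBB : a ∈ B → b ∈ B → c ∈ B → False := fun ha hb hc =>
        hB.noCyc ha hb hc h4 h5 h6
      have k1 := key _ _ h1
      have k4 := key _ _ h4
      have k5 := key _ _ h5
      have k6 := key _ _ h6
      have mv := hmem v
      have ma := hmem a
      have mb := hmem b
      have mc := hmem c
      have hAA : v ∈ A → a ∈ A → b ∈ A → c ∈ A → False := fun hv ha hb hc =>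
        hA.noD hv ha hb hc hd
      tauto
end

section
/- Let v_1,…,v_n be a matching ordering of a tournament G, and let v be a vertex of G with indegree b. Then v is either v_b, v_{b+1}, or v_{b+2}. Moreover, v = v_b if and only if v is the head of a backedge of the ordering, v = v_{b+2} if and only if v is the tail of a backedge, and v = v_{b+1} if and only if v is not an end of any backedge. -/
/-- In a matching ordering, a vertex of indegree `b` occupies position `b`, `b+1` or `b+2`
(1-indexed), according to whether it is the head of a backedge, not an end of a backedge,
or the tail of a backedge. (Positions here are 0-indexed, so position `p` corresponds to
the `(p+1)`-st vertex of the ordering.) -/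
theorem stmt8 {V : Type} [Fintype V] (T : Tournament V) {n : ℕ}
    (e : Fin n → V) (he : MatchingOrd T.rel e) (p : Fin n) (b : ℕ)
    (hb : {u : V | T.rel u (e p)}.ncard = b) :
    (p.val + 1 = b ∨ p.val + 1 = b + 1 ∨ p.val + 1 = b + 2) ∧
    (p.val + 1 = b ↔ ∃ q : Fin n, p < q ∧ T.rel (e q) (e p)) ∧
    (p.val + 1 = b + 2 ↔ ∃ q : Fin n, q < p ∧ T.rel (e p) (e q)) ∧
    (p.val + 1 = b + 1 ↔
      ¬ ∃ q : Fin n, (p < q ∧ T.rel (e q) (e p)) ∨ (q < p ∧ T.rel (e p) (e q))) := by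
  classical
  obtain ⟨hbij, hm⟩ := he
  have hs := hm p
  have hne : ∀ q, q ≠ p → (T.rel (e q) (e p) ∨ T.rel (e p) (e q)) :=
    fun q hq => T.total _ _ (fun h => hq (hbij.1 h))
  have hirr : ¬ T.rel (e p) (e p) := fun h => T.asymm _ _ h h
  -- transfer the indegree count to positions
  have hcard : (Finset.univ.filter (fun q : Fin n => T.rel (e q) (e p))).card = b := by
    rw [← hb, ← Set.ncard_coe_finset, ← Set.ncard_image_of_injective _ hbij.1]
    congr 1
    ext u
    obtain ⟨q, rfl⟩ := hbij.2 u
    simp [hbij.1.eq_iff]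
  have hIio : (Finset.Iio p).card = p.val := by simp
  have hA : ∀ q : Fin n, p < q → T.rel (e q) (e p) → p.val + 1 = b := by
    intro q hq hr
    have hS : Finset.univ.filter (fun q : Fin n => T.rel (e q) (e p))
        = insert q (Finset.Iio p) := by
      ext x
      simp only [Finset.mem_filter, Finset.mem_univ, true_and, Finset.mem_insert,
        Finset.mem_Iio]
      constructor
      · intro hx
        rcases lt_trichotomy x p with h | h | h
        · exact Or.inr h
        · subst h; exact absurd hx hirr
        · exact Or.inl (hs (Or.inl ⟨h, hx⟩) (Or.inl ⟨hq, hr⟩))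
      · rintro (rfl | h)
        · exact hr
        · rcases hne x h.ne with h' | h'
          · exact h'
          · have : x = q := hs (Or.inr ⟨h, h'⟩) (Or.inl ⟨hq, hr⟩)
            subst this
            exact hr
    rw [hS, Finset.card_insert_of_notMem (by simpa using hq.le), hIio] at hcard
    exact hcard
  have hB : ∀ q : Fin n, q < p → T.rel (e p) (e q) → p.val + 1 = b + 2 := by
    intro q hq hr
    have hS : Finset.univ.filter (fun q : Fin n => T.rel (e q) (e p))
        = (Finset.Iio p).erase q := by
      ext x
      simp only [Finset.mem_filter, Finset.mem_univ, true_and, Finset.mem_erase,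
        Finset.mem_Iio]
      constructor
      · intro hx
        have hxq : x ≠ q := by rintro rfl; exact T.asymm _ _ hx hr
        refine ⟨hxq, ?_⟩
        rcases lt_trichotomy x p with h | h | h
        · exact h
        · subst h; exact absurd hx hirr
        · exact absurd (hs (Or.inl ⟨h, hx⟩) (Or.inr ⟨hq, hr⟩)) hxq
      · rintro ⟨hxq, h⟩
        rcases hne x h.ne with h' | h'
        · exact h'
        · exact absurd (hs (Or.inr ⟨h, h'⟩) (Or.inr ⟨hq, hr⟩)) hxq
    rw [hS, Finset.card_erase_of_mem (by simpa using hq), hIio] at hcard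
    have : q.val < p.val := hq
    omega
  have hC : (¬ ∃ q : Fin n, (p < q ∧ T.rel (e q) (e p)) ∨ (q < p ∧ T.rel (e p) (e q))) →
      p.val + 1 = b + 1 := by
    intro hno
    have hS : Finset.univ.filter (fun q : Fin n => T.rel (e q) (e p)) = Finset.Iio p := by
      ext x
      simp only [Finset.mem_filter, Finset.mem_univ, true_and, Finset.mem_Iio]
      constructor
      · intro hx
        rcases lt_trichotomy x p with h | h | h
        · exact h
        · subst h; exact absurd hx hirr
        · exact absurd ⟨x, Or.inl ⟨h, hx⟩⟩ hno
      · intro h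
        rcases hne x h.ne with h' | h'
        · exact h'
        · exact absurd ⟨x, Or.inr ⟨h, h'⟩⟩ hno
    rw [hS, hIio] at hcard
    omega
  by_cases h : ∃ q : Fin n, (p < q ∧ T.rel (e q) (e p)) ∨ (q < p ∧ T.rel (e p) (e q))
  · obtain ⟨q, hq | hq⟩ := h
    · have h1 := hA q hq.1 hq.2
      refine ⟨Or.inl h1, ⟨fun _ => ⟨q, hq⟩, fun _ => h1⟩, ⟨fun h => by omega, ?_⟩,
        ⟨fun h => by omega, fun h => absurd ⟨q, Or.inl hq⟩ h⟩⟩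
      rintro ⟨x, hx⟩
      exact hB x hx.1 hx.2
    · have h1 := hB q hq.1 hq.2
      refine ⟨Or.inr (Or.inr h1), ⟨fun h => by omega, ?_⟩, ⟨fun _ => ⟨q, hq⟩, fun _ => h1⟩,
        ⟨fun h => by omega, fun h => absurd ⟨q, Or.inr hq⟩ h⟩⟩
      rintro ⟨x, hx⟩
      exact hA x hx.1 hx.2
  · have h1 := hC h
    refine ⟨Or.inr (Or.inl h1), ⟨fun h => by omega, ?_⟩, ⟨fun h => by omega, ?_⟩,
      ⟨fun _ => h, fun _ => h1⟩⟩
    · rintro ⟨x, hx⟩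
      exact absurd ⟨x, Or.inl hx⟩ h
    · rintro ⟨x, hx⟩
      exact absurd ⟨x, Or.inr hx⟩ h
end

section
/- Let σ be a permutation of {1,2,…,n} which can be written as a single cycle (x_1 x_2 … x_k) with k ≥ 1 (fixing all other points). If |σ(x) − x| ≤ 2 for all x ∈ {1,…,n}, then either the orbit X = {x_1,…,x_k} is a set of consecutive integers and σ = σ_X or σ = σ_X^{−1}, or else k = 2 and |x_1 − x_2| = 2. -/
theorem sigma_core_aux (F G : ℕ → ℕ) (hFG : ∀ y, F (G y) = y) (hGF : ∀ y, G (F y) = y)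
    (hF : ∀ y, F y ≤ y + 2 ∧ y ≤ F y + 2) (b : ℕ)
    (hlow : ∀ y, y < b → F y = y) (h0 : F b = b + 2) (h1 : F (b + 1) = b) (d : ℕ) :
    (∃ a, b + 2 ≤ a ∧ ∀ y, b ≤ y → y ≤ a → F y = sigmaX b a y) ∨
    ((∀ x, b ≤ x → x < b + 1 + d → (x - b) % 2 = 0 → F x = x + 2) ∧
      (∀ x, b ≤ x → x < b + 1 + d → (x - b) % 2 = 1 → F (x + 2) = x)) := by
  induction d with
  | zero =>
    right
    constructor
    · intro x hx hx2 _
      obtain rfl : x = b := by omega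
      exact h0
    · intro x hx hx2 hx3
      omega
  | succ d ih =>
    rcases ih with ih | ⟨he, ho⟩
    · exact Or.inl ih
    have inj : ∀ y z, F y = F z → y = z := by
      intro y z h
      rw [← hGF y, ← hGF z, h]
    obtain ⟨m, hm⟩ : ∃ m, m = b + 1 + d := ⟨_, rfl⟩
    rw [← hm] at he ho
    rw [show b + 1 + (d + 1) = m + 1 by omega]
    rcases Nat.mod_two_eq_zero_or_one (m - b) with hp | hp
    · have hm2 : b + 2 ≤ m := by omega
      have hne2 : F m ≠ m - 2 := by
        intro h
        rcases Nat.lt_or_ge m (b + 3) with h3 | h3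
        · have : m = b + 1 := inj _ _ (by rw [h, h1]; omega)
          omega
        · have h4 : b + 4 ≤ m := by omega
          have h5 := he (m - 4) (by omega) (by omega) (by omega)
          have := inj m (m - 4) (by rw [h, h5]; omega)
          omega
      have hne1 : F m ≠ m - 1 := by
        intro h
        have h5 := ho (m - 1) (by omega) (by omega) (by omega)
        have := inj m (m - 1 + 2) (by rw [h, h5])
        omega
      have hne0 : F m ≠ m := by
        intro h
        have h5 := he (m - 2) (by omega) (by omega) (by omega)
        have := inj m (m - 2) (by rw [h, h5]; omega)
        omega
      have hb := hF m
      rcases (by omega : F m = m + 1 ∨ F m = m + 2) with h | h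
      · left
        refine ⟨m + 1, by omega, ?_⟩
        intro y hy1 hy2
        unfold sigmaX
        rw [if_neg (by omega), if_neg (by omega)]
        split_ifs with c1 c2 c3 c4
        · exact he y hy1 (by omega) c1
        · obtain rfl : y = m := by omega
          exact h
        · omega
        · have := ho (y - 2) (by omega) (by omega) (by omega)
          rwa [show y - 2 + 2 = y by omega] at this
        · obtain rfl : y = b + 1 := by omega
          exact h1
      · right
        constructor
        · intro x hx1 hx2 hx3
          rcases Nat.lt_or_ge x m with hx | hx
          · exact he x hx1 hx hx3
          · obtain rfl : x = m := by omega
            exact h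
        · intro x hx1 hx2 hx3
          exact ho x hx1 (by omega) hx3
    · have hgm := hFG m
      have hb := hF (G m)
      rw [hgm] at hb
      have hne2 : G m + 2 ≠ m := by
        intro h
        rcases Nat.lt_or_ge m (b + 2) with h3 | h3
        · have := hlow (G m) (by omega)
          omega
        · rcases Nat.lt_or_ge m (b + 4) with h4 | h4
          · have : G m = b + 1 := by omega
            rw [this, h1] at hgm
            omega
          · have h5 := ho (m - 4) (by omega) (by omega) (by omega)
            rw [show G m = m - 4 + 2 by omega, h5] at hgm
            omega
      have hne1 : G m + 1 ≠ m := by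
        intro h
        have h5 := he (m - 1) (by omega) (by omega) (by omega)
        rw [show G m = m - 1 by omega, h5] at hgm
        omega
      have hne0 : G m ≠ m := by
        intro h
        rw [h] at hgm
        rcases Nat.lt_or_ge m (b + 2) with h3 | h3
        · rw [show m = b + 1 by omega, h1] at hgm
          omega
        · have h5 := ho (m - 2) (by omega) (by omega) (by omega)
          rw [show m - 2 + 2 = m by omega] at h5
          omega
      rcases (by omega : G m = m + 1 ∨ G m = m + 2) with h | h
      · rw [h] at hgm
        left
        refine ⟨m + 1, by omega, ?_⟩
        intro y hy1 hy2
        unfold sigmaX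
        rw [if_neg (by omega), if_neg (by omega)]
        split_ifs with c1 c2 c3 c4
        · exact he y hy1 (by omega) c1
        · omega
        · obtain rfl : y = m + 1 := by omega
          rw [hgm]; omega
        · have := ho (y - 2) (by omega) (by omega) (by omega)
          rwa [show y - 2 + 2 = y by omega] at this
        · obtain rfl : y = b + 1 := by omega
          exact h1
      · rw [h] at hgm
        right
        constructor
        · intro x hx1 hx2 hx3
          exact he x hx1 (by omega) hx3
        · intro x hx1 hx2 hx3
          rcases Nat.lt_or_ge x m with hx | hx
          · exact ho x hx1 hx hx3
          · obtain rfl : x = m := by omega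
            exact hgm

theorem sigma_core (F G : ℕ → ℕ) (hFG : ∀ y, F (G y) = y) (hGF : ∀ y, G (F y) = y)
    (hF : ∀ y, F y ≤ y + 2 ∧ y ≤ F y + 2) (b N : ℕ) (hN : ∀ y, N ≤ y → F y = y)
    (hlow : ∀ y, y < b → F y = y) (h0 : F b = b + 2) (h1 : F (b + 1) = b) :
    ∃ a, b + 2 ≤ a ∧ ∀ y, b ≤ y → y ≤ a → F y = sigmaX b a y := by
  rcases sigma_core_aux F G hFG hGF hF b hlow h0 h1 (2 * N + 1) with h | ⟨h, -⟩
  · exact h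
  · have h2 := h (b + 2 * N) (by omega) (by omega) (by omega)
    have h3 := hN (b + 2 * N) (by omega)
    omega

theorem sigmaX_range (b a y : ℕ) (hab : b + 2 ≤ a) (h1 : b ≤ y) (h2 : y ≤ a) :
    b ≤ sigmaX b a y ∧ sigmaX b a y ≤ a ∧ sigmaX b a y ≠ y := by
  unfold sigmaX
  split_ifs <;> omega

theorem sigma_gen {n : ℕ} (σ : Equiv.Perm (Fin n)) (X : Set (Fin n))
    (hfix : ∀ y, y ∉ X → σ y = y)
    (htr : ∀ S : Set (Fin n), (∀ y ∈ S, σ y ∈ S) → (∃ y ∈ X, y ∈ S) → X ⊆ S)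
    (hstep : ∀ y : Fin n, (σ y : ℕ) ≤ y + 2 ∧ (y : ℕ) ≤ σ y + 2)
    (b : Fin n) (hb : b ∈ X) (hmin : ∀ y ∈ X, b ≤ y)
    (h0 : (σ b : ℕ) = b + 2) (h1 : (σ.symm b : ℕ) = b + 1) :
    ∃ b a : ℕ, (Fin.val '' X) = Set.Icc b a ∧ ∀ y : Fin n, (σ y : ℕ) = sigmaX b a y.val := by
  obtain ⟨a, hab, ha⟩ := sigma_core
    (fun y => if h : y < n then (σ ⟨y, h⟩ : ℕ) else y)
    (fun y => if h : y < n then (σ.symm ⟨y, h⟩ : ℕ) else y)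
    (by intro y; by_cases h : y < n <;> simp [h])
    (by intro y; by_cases h : y < n <;> simp [h])
    (by
      intro y
      by_cases h : y < n
      · simpa [h] using hstep ⟨y, h⟩
      · simp [h])
    b n
    (by intro y h; simp [Nat.not_lt.mpr h])
    (by
      intro y h
      have hy : y < n := by omega
      have : σ ⟨y, hy⟩ = ⟨y, hy⟩ := by
        apply hfix
        intro hX
        have := hmin _ hX
        rw [Fin.le_def] at this
        simp at this
        omega
      simp [hy, this])
    (by simpa using h0)
    (by
      have hy : (b : ℕ) + 1 < n := by rw [← h1]; exact (σ.symm b).isLt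
      have : (⟨b + 1, hy⟩ : Fin n) = σ.symm b := Fin.ext h1.symm
      simp [hy, this])
  have ha' : ∀ y : Fin n, (b : ℕ) ≤ y → (y : ℕ) ≤ a → (σ y : ℕ) = sigmaX b a y := by
    intro y hy1 hy2
    simpa using ha y hy1 hy2
  have han : a < n := by
    by_contra hcon
    have h2 := ha n b.isLt.le (by omega)
    have h3 := (sigmaX_range b a n hab b.isLt.le (by omega)).2.2
    simp at h2
    omega
  have hsub : X ⊆ {y : Fin n | (b : ℕ) ≤ y ∧ (y : ℕ) ≤ a} := by
    apply htr
    · rintro y ⟨hy1, hy2⟩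
      have h3 := sigmaX_range b a y hab hy1 hy2
      simp only [Set.mem_setOf_eq]
      rw [ha' y hy1 hy2]
      exact ⟨h3.1, h3.2.1⟩
    · exact ⟨b, hb, le_refl _, by omega⟩
  have hsup : ∀ y : Fin n, (b : ℕ) ≤ y → (y : ℕ) ≤ a → y ∈ X := by
    intro y hy1 hy2
    by_contra hcon
    have h2 := ha' y hy1 hy2
    rw [hfix y hcon] at h2
    exact (sigmaX_range b a y hab hy1 hy2).2.2 h2.symm
  refine ⟨b, a, ?_, ?_⟩
  · ext z
    constructor
    · rintro ⟨y, hy, rfl⟩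
      exact hsub hy
    · rintro ⟨hz1, hz2⟩
      exact ⟨⟨z, by omega⟩, hsup _ hz1 hz2, rfl⟩
  · intro y
    by_cases hy : (b : ℕ) ≤ y ∧ (y : ℕ) ≤ a
    · exact ha' y hy.1 hy.2
    · rw [hfix y (fun hX => hy (hsub hX))]
      unfold sigmaX
      rw [if_pos (by omega)]

/-- If a permutation `σ` of `{0, …, n-1}` is a single cycle `(x_1 … x_k)` with `k ≥ 1`
and moves every point by at most 2, then either its orbit `X` is a set of consecutive
integers and `σ = σ_X` or `σ = σ_X⁻¹`, or `k = 2` and the two moved points differ by 2. -/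
theorem stmt9 {n k : ℕ} (hk : 0 < k) (σ : Equiv.Perm (Fin n))
    (x : Fin k → Fin n) (hinj : Function.Injective x)
    (hcyc : ∀ i : Fin k, σ (x i) = x ⟨(i.val + 1) % k, Nat.mod_lt _ hk⟩)
    (hfix : ∀ y : Fin n, y ∉ Set.range x → σ y = y)
    (hstep : ∀ y : Fin n, (((σ y : ℕ) : ℤ) - ((y : ℕ) : ℤ)).natAbs ≤ 2) :
    (∃ b a : ℕ, (Fin.val '' Set.range x) = Set.Icc b a ∧
      ((∀ y : Fin n, (σ y : ℕ) = sigmaX b a y.val) ∨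
       (∀ y : Fin n, (σ.symm y : ℕ) = sigmaX b a y.val))) ∨
    (k = 2 ∧ ∀ i j : Fin k, i ≠ j → (((x i : ℕ) : ℤ) - ((x j : ℕ) : ℤ)).natAbs = 2) := by
  have hstep' : ∀ y : Fin n, (σ y : ℕ) ≤ y + 2 ∧ (y : ℕ) ≤ σ y + 2 := by
    intro y
    have := hstep y
    omega
  have htr : ∀ S : Set (Fin n), (∀ y ∈ S, σ y ∈ S) → (∃ y ∈ Set.range x, y ∈ S) →
      Set.range x ⊆ S := by
    rintro S hS ⟨_, ⟨i0, rfl⟩, hi0⟩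
    have key : ∀ d : ℕ, x ⟨(i0.val + d) % k, Nat.mod_lt _ hk⟩ ∈ S := by
      intro d
      induction d with
      | zero => simpa [Nat.mod_eq_of_lt i0.isLt] using hi0
      | succ d ih =>
        have := hS _ ih
        rw [hcyc] at this
        simpa [Nat.add_assoc] using this
    rintro _ ⟨i, rfl⟩
    have h := key (i.val + k - i0.val)
    have h2 : (i0.val + (i.val + k - i0.val)) % k = i.val := by
      rw [show i0.val + (i.val + k - i0.val) = i.val + k by omega, Nat.add_mod_right,
        Nat.mod_eq_of_lt i.isLt]
    simpa [h2] using h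
  have hXs : ∀ y ∈ Set.range x, σ y ∈ Set.range x := by
    rintro _ ⟨i, rfl⟩
    exact ⟨_, (hcyc i).symm⟩
  have hfix' : ∀ y, y ∉ Set.range x → σ.symm y = y := by
    intro y hy
    rw [Equiv.symm_apply_eq, hfix y hy]
  have hXs' : ∀ y ∈ Set.range x, σ.symm y ∈ Set.range x := by
    intro y hy
    by_contra hcon
    have := hfix _ hcon
    rw [Equiv.apply_symm_apply] at this
    rw [← this] at hcon
    exact hcon hy
  have htr' : ∀ S : Set (Fin n), (∀ y ∈ S, σ.symm y ∈ S) → (∃ y ∈ Set.range x, y ∈ S) →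
      Set.range x ⊆ S := by
    rintro S hS ⟨y, hy, hyS⟩
    by_contra hcon
    obtain ⟨z, hz, hzS⟩ := Set.not_subset.mp hcon
    have := htr Sᶜ (by
      intro w hw hw2
      apply hw
      simpa using hS _ hw2) ⟨z, hz, hzS⟩
    exact this hy hyS
  have hstep2 : ∀ y : Fin n, (σ.symm y : ℕ) ≤ y + 2 ∧ (y : ℕ) ≤ σ.symm y + 2 := by
    intro y
    have := hstep' (σ.symm y)
    rw [Equiv.apply_symm_apply] at this
    exact ⟨this.2, this.1⟩
  obtain ⟨b, hb, hmin⟩ : ∃ b ∈ Set.range x, ∀ y ∈ Set.range x, b ≤ y := by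
    obtain ⟨b, hb, hm⟩ := Set.exists_min_image (Set.range x) id (Set.finite_range x)
      ⟨x ⟨0, hk⟩, ⟨_, rfl⟩⟩
    exact ⟨b, hb, hm⟩
  by_cases hsb : σ b = b
  · left
    have hX : Set.range x = {b} := by
      apply Set.Subset.antisymm
      · apply htr
        · rintro y rfl
          exact hsb
        · exact ⟨b, hb, rfl⟩
      · rintro y rfl
        exact hb
    refine ⟨b, b, by rw [hX]; simp, Or.inl ?_⟩
    intro y
    have : σ y = y := by
      by_cases hy : y = b
      · rw [hy, hsb]
      · exact hfix y (by rw [hX]; exact hy)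
    rw [this]
    simp [sigmaX]
  have hsb' : σ.symm b ≠ b := by
    intro h
    exact hsb (by rw [Equiv.symm_apply_eq] at h; exact h.symm)
  have e1 : (b : ℕ) ≤ σ b := hmin _ (hXs b hb)
  have e2 : (b : ℕ) ≤ σ.symm b := hmin _ (hXs' b hb)
  have e3 := (hstep' b).1
  have e4 := (hstep2 b).1
  have e5 : (σ b : ℕ) ≠ b := fun h => hsb (Fin.ext h)
  have e6 : (σ.symm b : ℕ) ≠ b := fun h => hsb' (Fin.ext h)
  by_cases heq : σ b = σ.symm b
  · have hcb : σ (σ b) = b := by rw [heq, Equiv.apply_symm_apply]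
    have hX : Set.range x = {b, σ b} := by
      apply Set.Subset.antisymm
      · apply htr
        · rintro y (rfl | rfl)
          · exact Or.inr rfl
          · exact Or.inl hcb
        · exact ⟨b, hb, Or.inl rfl⟩
      · rintro y (rfl | rfl)
        · exact hb
        · exact hXs b hb
    rcases (by omega : (σ b : ℕ) = b + 1 ∨ (σ b : ℕ) = b + 2) with h | h
    · left
      refine ⟨b, b + 1, ?_, Or.inl ?_⟩
      · rw [hX, Set.image_pair, h]
        ext z
        simp only [Set.mem_insert_iff, Set.mem_singleton_iff, Set.mem_Icc]
        omega
      · intro y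
        by_cases hy : y ∈ Set.range x
        · have hy' := hy
          rw [hX] at hy'
          rcases hy' with rfl | hy'
          · rw [h]; unfold sigmaX
            split_ifs <;> omega
          · rw [hy', hcb, h]
            unfold sigmaX
            split_ifs <;> omega
        · rw [hfix y hy]
          have hn1 : (y : ℕ) ≠ b := fun hh => hy (by rw [Fin.ext hh]; exact hb)
          have hn2 : (y : ℕ) ≠ σ b := fun hh => hy (by rw [Fin.ext hh]; exact hXs b hb)
          unfold sigmaX
          rw [if_pos (by omega)]
    · right
      constructor
      · have h1 : (Set.range x).ncard = k := by
          rw [← Set.image_univ, Set.ncard_image_of_injective _ hinj, Set.ncard_univ]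
          simp
        rw [← h1, hX, Set.ncard_pair (fun hh => hsb hh.symm)]
      · intro i j hij
        have hne : x i ≠ x j := fun hh => hij (hinj hh)
        have hi : x i ∈ Set.range x := ⟨i, rfl⟩
        have hj : x j ∈ Set.range x := ⟨j, rfl⟩
        rw [hX] at hi hj
        rcases hi with hi | hi <;> rcases hj with hj | hj
        · exact absurd (hi.trans hj.symm) hne
        · rw [hi, hj, h]; omega
        · rw [hi, hj, h]; omega
        · exact absurd (hi.trans hj.symm) hne
  · have hne : (σ b : ℕ) ≠ σ.symm b := fun h => heq (Fin.ext h)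
    left
    rcases (by omega : (σ b : ℕ) = b + 2 ∧ (σ.symm b : ℕ) = b + 1 ∨
      (σ b : ℕ) = b + 1 ∧ (σ.symm b : ℕ) = b + 2) with ⟨h0, h1⟩ | ⟨h0, h1⟩
    · obtain ⟨b', a, hX, h⟩ := sigma_gen σ (Set.range x) hfix htr hstep' b hb hmin h0 h1
      exact ⟨b', a, hX, Or.inl h⟩
    · obtain ⟨b', a, hX, h⟩ := sigma_gen σ.symm (Set.range x) hfix' htr' hstep2 b hb hmin h1
        (by simpa using h0)
      exact ⟨b', a, hX, Or.inr h⟩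
end

section
/- Let G be a tournament with matching ordering v_1,…,v_n, let X = {1,…,n}, and let σ ∈ S_n be such that v_{σ(1)},…,v_{σ(n)} is also a matching ordering of G. Then: (i) if σ = σ_X, then G is either transitive or isomorphic to P_n, and the ordering v_1,…,v_n is π_2 G; (ii) if σ = σ_X^{−1}, then G is either transitive or isomorphic to P_n, and the ordering v_1,…,v_n is π_1 G; (iii) if n = 4 and σ = τ_X, then G is isomorphic to P_4, and the ordering v_1,…,v_n is either π_2 G or π_2 π_1 G. -/
theorem pi1N_lt {n x : ℕ} (hx : x < n) : pi1N 0 (n - 1) x < n := by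
  unfold pi1N; split_ifs <;> first | omega | grind

theorem pi2N_lt {n x : ℕ} (hx : x < n) : pi2N 0 (n - 1) x < n := by
  unfold pi2N; split_ifs <;> first | omega | grind

theorem pi1N_invol {n x : ℕ} (hx : x < n) : pi1N 0 (n - 1) (pi1N 0 (n - 1) x) = x := by
  unfold pi1N; split_ifs <;> first | omega | grind

theorem pi2N_invol {n x : ℕ} (hx : x < n) : pi2N 0 (n - 1) (pi2N 0 (n - 1) x) = x := by
  unfold pi2N; split_ifs <;> first | omega | grind

theorem sigma_pi {n x : ℕ} (hx : x < n) :
    sigmaX 0 (n - 1) (pi1N 0 (n - 1) x) = pi2N 0 (n - 1) x := by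
  unfold sigmaX pi1N pi2N; split_ifs <;> first | omega | grind

theorem pi1N_far {n x y : ℕ} (hy : y < n) (h : x + 2 ≤ y) :
    pi1N 0 (n - 1) x < pi1N 0 (n - 1) y := by
  unfold pi1N; split_ifs <;> first | omega | grind

theorem pi2N_far {n x y : ℕ} (hy : y < n) (h : x + 2 ≤ y) :
    pi2N 0 (n - 1) x < pi2N 0 (n - 1) y := by
  unfold pi2N; split_ifs <;> first | omega | grind

theorem pi_near {n x : ℕ} (hy : x + 1 < n) :
    (x % 2 = 0 ∧ pi1N 0 (n - 1) (x + 1) < pi1N 0 (n - 1) x ∧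
      pi2N 0 (n - 1) x < pi2N 0 (n - 1) (x + 1)) ∨
    (x % 2 = 1 ∧ pi1N 0 (n - 1) x < pi1N 0 (n - 1) (x + 1) ∧
      pi2N 0 (n - 1) (x + 1) < pi2N 0 (n - 1) x) := by
  unfold pi1N pi2N; split_ifs <;> first | omega | grind

/-- The pair `{x, y}` spans a backedge when the vertices `f x` are put at positions `p x`. -/
def BackP {V : Type} (T : Tournament V) (f : ℕ → V) (p : ℕ → ℕ) (x y : ℕ) : Prop :=
  (p x < p y ∧ T.rel (f y) (f x)) ∨ (p y < p x ∧ T.rel (f x) (f y))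

theorem BackP.symm {V : Type} {T : Tournament V} {f : ℕ → V} {p : ℕ → ℕ} {x y : ℕ}
    (h : BackP T f p x y) : BackP T f p y x := Or.symm h

theorem core {V : Type} (T : Tournament V) (n : ℕ) (f : ℕ → V)
    (hf : ∀ x y, x < n → y < n → x ≠ y → f x ≠ f y)
    (H1 : ∀ x y z, x < n → y < n → z < n → BackP T f (pi1N 0 (n - 1)) x y →
      BackP T f (pi1N 0 (n - 1)) x z → y = z)
    (H2 : ∀ x y z, x < n → y < n → z < n → BackP T f (pi2N 0 (n - 1)) x y →
      BackP T f (pi2N 0 (n - 1)) x z → y = z) :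
    (∀ x y, x < y → y < n → T.rel (f x) (f y)) ∨
    (∀ x y, x < n → y < n → (T.rel (f x) (f y) ↔ (x + 2 ≤ y ∨ x = y + 1))) := by
  have near : ∀ x, x + 1 < n → BackP T f (pi1N 0 (n - 1)) x (x + 1) ∨
      BackP T f (pi2N 0 (n - 1)) x (x + 1) := by
    intro x hx
    have ht := T.total (f x) (f (x + 1)) (hf _ _ (by omega) hx (by omega))
    unfold BackP
    rcases pi_near hx with ⟨_, h1, h2⟩ | ⟨_, h1, h2⟩ <;> tauto
  have far : ∀ x y, x + 2 ≤ y → y < n → T.rel (f x) (f y) := by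
    intro x y hxy hy
    rcases T.total (f x) (f y) (hf _ _ (by omega) hy (by omega)) with h | h
    · exact h
    · exfalso
      rcases near x (by omega) with hb | hb
      · have := H1 x (x + 1) y (by omega) (by omega) hy hb (Or.inl ⟨pi1N_far hy hxy, h⟩)
        omega
      · have := H2 x (x + 1) y (by omega) (by omega) hy hb (Or.inl ⟨pi2N_far hy hxy, h⟩)
        omega
  have step : ∀ x, x + 2 < n →
      (T.rel (f x) (f (x + 1)) ↔ T.rel (f (x + 1)) (f (x + 2))) := by
    intro x hx
    have ta := T.total (f x) (f (x + 1)) (hf _ _ (by omega) (by omega) (by omega))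
    have tb := T.total (f (x + 1)) (f (x + 2)) (hf _ _ (by omega) (by omega) (by omega))
    have h1 := H1 (x + 1) x (x + 2) (by omega) (by omega) (by omega)
    have h2 := H2 (x + 1) x (x + 2) (by omega) (by omega) (by omega)
    have h1' : ¬ (BackP T f (pi1N 0 (n - 1)) (x + 1) x ∧
      BackP T f (pi1N 0 (n - 1)) (x + 1) (x + 2)) := fun h => by
        have := h1 h.1 h.2
        omega
    have h2' : ¬ (BackP T f (pi2N 0 (n - 1)) (x + 1) x ∧
      BackP T f (pi2N 0 (n - 1)) (x + 1) (x + 2)) := fun h => by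
        have := h2 h.1 h.2
        omega
    clear h1 h2
    unfold BackP at h1' h2'
    have pn := pi_near (n := n) (x := x + 1) (by omega)
    rw [show x + 1 + 1 = x + 2 from rfl] at pn
    rcases pi_near (n := n) (x := x) (by omega) with ⟨m, p1, p2⟩ | ⟨m, p1, p2⟩ <;>
    rcases pn with ⟨m', q1, q2⟩ | ⟨m', q1, q2⟩ <;>
    first
    | omega
    | (simp only [p1, p2, q1, q2, not_lt_of_gt p1, not_lt_of_gt p2, not_lt_of_gt q1,
        not_lt_of_gt q2, true_and, false_and, or_false, false_or] at h1' h2'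
       clear H1 H2 near far
       constructor
       · intro h
         rcases tb with tb | tb
         · exact tb
         · exact (not_and_or.1 h1').elim (by tauto) (by tauto)
       · intro h
         rcases ta with ta | ta
         · exact ta
         · exact (not_and_or.1 h1').elim (by tauto) (by tauto))
  have const : ∀ x, x + 1 < n → (T.rel (f x) (f (x + 1)) ↔ T.rel (f 0) (f 1)) := by
    intro x
    induction x with
    | zero => intro _; exact Iff.rfl
    | succ k ih => intro hk; rw [← step k (by omega)]; exact ih (by omega)
  by_cases h0 : T.rel (f 0) (f 1)
  · left
    intro x y hxy hy
    by_cases h : x + 2 ≤ y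
    · exact far x y h hy
    · obtain rfl : y = x + 1 := by omega
      exact (const x hy).2 h0
  · right
    intro x y hx hy
    have back : ∀ z, z + 1 < n → T.rel (f (z + 1)) (f z) := fun z hz =>
      (T.total (f z) (f (z + 1)) (hf _ _ (by omega) hz (by omega))).resolve_left
        (fun h => h0 ((const z hz).1 h))
    constructor
    · intro h
      by_contra hc
      have : x = y ∨ y = x + 1 ∨ y + 2 ≤ x := by omega
      rcases this with rfl | rfl | h'
      · exact T.asymm _ _ h h
      · exact T.asymm _ _ h (back x hy)
      · exact T.asymm _ _ h (far y x h' hx)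
    · rintro (h | rfl)
      · exact far x y h hy
      · exact back y hx

theorem backP_of_matching {V : Type} (T : Tournament V) {n : ℕ} (e : Fin n → V)
    (he : MatchingOrd T.rel e) (f : ℕ → V) (p : ℕ → ℕ) (hp : ∀ x, x < n → p x < n)
    (hpp : ∀ x, x < n → p (p x) = x)
    (hf : ∀ x (h : x < n), f x = e ⟨p x, hp x h⟩) :
    ∀ x y z, x < n → y < n → z < n → BackP T f p x y → BackP T f p x z → y = z := by
  intro x y z hx hy hz h1 h2
  unfold BackP at h1 h2
  rw [hf x hx, hf y hy] at h1
  rw [hf x hx, hf z hz] at h2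
  have := he.2 ⟨p x, hp x hx⟩ (x := ⟨p y, hp y hy⟩) h1 (y := ⟨p z, hp z hz⟩) h2
  have h3 : p y = p z := congrArg Fin.val this
  rw [← hpp y hy, ← hpp z hz, h3]

theorem both {V : Type} (T : Tournament V) {n : ℕ} (hn : 1 ≤ n)
    (e w : Fin n → V) (he : MatchingOrd T.rel e) (hw : MatchingOrd T.rel w)
    (hew : ∀ x, ∀ i j : Fin n, x < n → i.val = pi2N 0 (n - 1) x → j.val = pi1N 0 (n - 1) x →
      e i = w j) :
    (SegTrans T e 0 (n - 1) (pi2N 0 (n - 1)) ∨ SegP T e 0 (n - 1) (pi2N 0 (n - 1))) ∧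
    (SegTrans T w 0 (n - 1) (pi1N 0 (n - 1)) ∨ SegP T w 0 (n - 1) (pi1N 0 (n - 1))) := by
  let f : ℕ → V := fun x =>
    if h : x < n then e ⟨pi2N 0 (n - 1) x, pi2N_lt h⟩ else e ⟨0, hn⟩
  have fe : ∀ x (h : x < n), f x = e ⟨pi2N 0 (n - 1) x, pi2N_lt h⟩ := fun x h => by
    simp only [f, dif_pos h]
  have fw : ∀ x (h : x < n), f x = w ⟨pi1N 0 (n - 1) x, pi1N_lt h⟩ := fun x h => by
    rw [fe x h]; exact hew x _ _ h rfl rfl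
  have hinj : ∀ x y, x < n → y < n → x ≠ y → f x ≠ f y := by
    intro x y hx hy hne h
    rw [fe x hx, fe y hy] at h
    have h3 : pi2N 0 (n - 1) x = pi2N 0 (n - 1) y := congrArg Fin.val (he.1.1 h)
    apply hne
    rw [← pi2N_invol hx, ← pi2N_invol hy, h3]
  have he' : ∀ i : Fin n, e i = f (pi2N 0 (n - 1) i.val) := fun i => by
    rw [fe _ (pi2N_lt i.2)]
    congr 1
    exact Fin.ext (pi2N_invol i.2).symm
  have hw' : ∀ i : Fin n, w i = f (pi1N 0 (n - 1) i.val) := fun i => by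
    rw [fw _ (pi1N_lt i.2)]
    congr 1
    exact Fin.ext (pi1N_invol i.2).symm
  rcases core T n f hinj
      (backP_of_matching T w hw f _ (fun _ => pi1N_lt) (fun _ => pi1N_invol) fw)
      (backP_of_matching T e he f _ (fun _ => pi2N_lt) (fun _ => pi2N_invol) fe) with h | h
  · exact ⟨Or.inl ⟨f, fun x y _ hxy hy => h x y hxy (by omega), fun i _ _ => he' i⟩,
      Or.inl ⟨f, fun x y _ hxy hy => h x y hxy (by omega), fun i _ _ => hw' i⟩⟩
  · exact ⟨Or.inr ⟨f, fun x y _ hx _ hy => h x y (by omega) (by omega), fun i _ _ => he' i⟩,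
      Or.inr ⟨f, fun x y _ hx _ hy => h x y (by omega) (by omega), fun i _ _ => hw' i⟩⟩

/-- Building `P_4` from an explicit list of four vertices. -/
theorem mkP4 {V : Type} (T : Tournament V) (a b c d : V)
    (h10 : T.rel b a) (h21 : T.rel c b) (h32 : T.rel d c)
    (h02 : T.rel a c) (h03 : T.rel a d) (h13 : T.rel b d) :
    ∀ x y : ℕ, 0 ≤ x → x ≤ 3 → 0 ≤ y → y ≤ 3 →
      (T.rel ((fun k : ℕ => if k = 0 then a else if k = 1 then b else if k = 2 then c else d) x)
        ((fun k : ℕ => if k = 0 then a else if k = 1 then b else if k = 2 then c else d) y) ↔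
        (x + 2 ≤ y ∨ x = y + 1)) := by
  have irr : ∀ v, ¬ T.rel v v := fun v h => T.asymm v v h h
  have n1 := T.asymm _ _ h10
  have n2 := T.asymm _ _ h21
  have n3 := T.asymm _ _ h32
  have n4 := T.asymm _ _ h02
  have n5 := T.asymm _ _ h03
  have n6 := T.asymm _ _ h13
  intro x y _ hx _ hy
  interval_cases x <;> interval_cases y <;> simp [*]

theorem part3 {V : Type} (T : Tournament V) (e : Fin 4 → V) (he : MatchingOrd T.rel e)
    (w : Fin 4 → V) (hw : MatchingOrd T.rel w)
    (w0 : w 0 = e 2) (w1 : w 1 = e 3) (w2 : w 2 = e 0) (w3 : w 3 = e 1) :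
    (SegP T e 0 3 (pi2N 0 3) ∨ SegP T e 0 3 (fun x => pi1N 0 3 (pi2N 0 3 x))) := by
  have key : ∀ (u : Fin 4 → V), MatchingOrd T.rel u → ∀ i j k : Fin 4, j ≠ k →
      ¬ (((i < j ∧ T.rel (u j) (u i)) ∨ (j < i ∧ T.rel (u i) (u j))) ∧
        ((i < k ∧ T.rel (u k) (u i)) ∨ (k < i ∧ T.rel (u i) (u k)))) :=
    fun u hu i j k hjk h => hjk (hu.2 i h.1 h.2)
  have tot : ∀ i j : Fin 4, i ≠ j → T.rel (e i) (e j) ∨ T.rel (e j) (e i) := fun i j h =>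
    T.total _ _ (fun h' => h (he.1.1 h'))
  have ke := key e he
  have kw := key w hw
  have t01 := tot 0 1 (by decide)
  have t02 := tot 0 2 (by decide)
  have t03 := tot 0 3 (by decide)
  have t12 := tot 1 2 (by decide)
  have t13 := tot 1 3 (by decide)
  have t23 := tot 2 3 (by decide)
  have e0 := ke 0 2 3 (by decide)
  have e1 := ke 1 2 3 (by decide)
  have e2 := ke 2 0 1 (by decide)
  have e3 := ke 3 0 1 (by decide)
  have f0 := kw 0 2 3 (by decide)
  have f1 := kw 1 2 3 (by decide)
  have f2 := kw 2 0 1 (by decide)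
  have f3 := kw 3 0 1 (by decide)
  have g1 := ke 0 1 2 (by decide)
  have g2 := ke 0 1 3 (by decide)
  have g3 := ke 2 3 0 (by decide)
  have g4 := ke 2 3 1 (by decide)
  simp only [w0, w1, w2, w3] at f0 f1 f2 f3
  simp [-not_and, -not_or] at e0 e1 e2 e3 f0 f1 f2 f3 g1 g2 g3 g4
  have main : (T.rel (e 0) (e 1) ∧ T.rel (e 2) (e 3)) ∧
      ((T.rel (e 2) (e 0) ∧ T.rel (e 3) (e 1) ∧ T.rel (e 0) (e 3) ∧ T.rel (e 1) (e 2)) ∨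
      (T.rel (e 3) (e 0) ∧ T.rel (e 2) (e 1) ∧ T.rel (e 0) (e 2) ∧ T.rel (e 1) (e 3))) := by
    clear ke kw key tot w0 w1 w2 w3 hw he
    generalize T.rel (e 0) (e 1) = a at *
    generalize T.rel (e 1) (e 0) = a' at *
    generalize T.rel (e 2) (e 3) = b at *
    generalize T.rel (e 3) (e 2) = b' at *
    grind
  obtain ⟨⟨h01, h23⟩, ⟨h20, h31, h03, h12⟩ | ⟨h30, h21, h02, h13⟩⟩ := main
  · left
    refine ⟨_, mkP4 T (e 0) (e 2) (e 1) (e 3) h20 h12 h31 h01 h03 h23, ?_⟩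
    intro i _ _
    fin_cases i <;> simp [pi2N]
  · right
    refine ⟨_, mkP4 T (e 2) (e 0) (e 3) (e 1) h02 h30 h13 h23 h21 h01, ?_⟩
    intro i _ _
    fin_cases i <;> simp [pi2N, pi1N]

/-- If `v_1, …, v_n` (given by `e`) and `v_{σ(1)}, …, v_{σ(n)}` are both matching
orderings of `G`, then: (i) if `σ = σ_X` (`X = {1, …, n}`) then `G` is transitive or
isomorphic to `P_n` and `e` is the ordering `π₂ G`; (ii) if `σ = σ_X⁻¹` then `G` is
transitive or isomorphic to `P_n` and `e` is `π₁ G`; (iii) if `n = 4` and `σ = τ_X`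
then `G` is isomorphic to `P_4` and `e` is `π₂ G` or `π₂π₁ G`.
(Positions are 0-indexed, so `X` becomes `{0, …, n-1}`.) -/
theorem stmt10 {V : Type} [Fintype V] (T : Tournament V) {n : ℕ} (hn : 1 ≤ n)
    (e : Fin n → V) (he : MatchingOrd T.rel e)
    (σ : Equiv.Perm (Fin n)) (hσ : MatchingOrd T.rel (e ∘ σ)) :
    ((∀ i : Fin n, (σ i : ℕ) = sigmaX 0 (n - 1) i.val) →
      (SegTrans T e 0 (n - 1) (pi2N 0 (n - 1)) ∨ SegP T e 0 (n - 1) (pi2N 0 (n - 1)))) ∧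
    ((∀ i : Fin n, (σ.symm i : ℕ) = sigmaX 0 (n - 1) i.val) →
      (SegTrans T e 0 (n - 1) (pi1N 0 (n - 1)) ∨ SegP T e 0 (n - 1) (pi1N 0 (n - 1)))) ∧
    (n = 4 → (∀ i : Fin n, (σ i : ℕ) = tauX 0 i.val) →
      (SegP T e 0 (n - 1) (pi2N 0 (n - 1)) ∨
        SegP T e 0 (n - 1) (fun x => pi1N 0 (n - 1) (pi2N 0 (n - 1) x)))) := by
  refine ⟨fun h => ?_, fun h => ?_, ?_⟩
  · refine (both T hn e (e ∘ σ) he hσ ?_).1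
    intro x i j hx hi hj
    have : i = σ j := Fin.ext (by rw [h j, hj, hi, sigma_pi hx])
    rw [this]; rfl
  · refine (both T hn (e ∘ σ) e hσ he ?_).2
    intro x i j hx hi hj
    have : i = σ.symm j := Fin.ext (by rw [h j, hj, hi, sigma_pi hx])
    rw [this]; simp
  · rintro rfl h
    have hh : ∀ i j : Fin 4, tauX 0 i.val = j.val → (e ∘ σ) i = e j := fun i j hij => by
      have : σ i = j := Fin.ext (by rw [h i, hij])
      simp [this]
    exact part3 T e he (e ∘ σ) hσ (hh 0 2 (by decide)) (hh 1 3 (by decide))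
      (hh 2 0 (by decide)) (hh 3 1 (by decide))
end
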